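/- There exist absolute constants c > 0 and C > 0 such that the following holds. Let F be a field and let A, B ⊆ F be finite nonempty sets with A ≠ {0}. If F has positive characteristic p, assume |A|^2 · |B| ≤ c · p^2. Then |f(A,B)| ≥ C · min{ |A|^{1/2} |B|^{3/4} , |B|^2 }, where f(x,y) = x^2 + x·y and f(A,B) = { a^2 + a·b : a ∈ A, b ∈ B }. -/

import Mathlib

open scoped Classical

open Polynomial in
/-- The line `{(u, y - x u, z - x y + x² u)}` attached to `q = (x, y, z)`, as the restriction
homomorphism from polynomial functions on `K³` to polynomials in `u`. -/
noncomputable def restrictLine {K : Type*} [Field K] (q : K × K × K) :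
    MvPolynomial (Fin 3) K →ₐ[K] K[X] :=
  MvPolynomial.aeval ![X, C q.2.1 - C q.1 * X, C (q.2.2 - q.1 * q.2.1) + C (q.1 ^ 2) * X]

/-- Polynomials whose degree in the `i`-th variable is at most `a i`. -/
noncomputable def degreeBox (K : Type*) [Field K] (a : Fin 3 → ℕ) :
    Submodule K (MvPolynomial (Fin 3) K) :=
  MvPolynomial.restrictSupport K {f | ∀ i, f i ≤ a i}

section Bezout

open MvPolynomial

variable {K : Type*} [Field K]

lemma natDegree_restrictLine_le (q : K × K × K) (P : MvPolynomial (Fin 3) K) :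
    (restrictLine q P).natDegree ≤ P.totalDegree := by
  have := MvPolynomial.aeval_natDegree_le P le_rfl
    ![(Polynomial.X : Polynomial K), Polynomial.C q.2.1 - Polynomial.C q.1 * Polynomial.X,
      Polynomial.C (q.2.2 - q.1 * q.2.1) + Polynomial.C (q.1 ^ 2) * Polynomial.X] (n := 1) (by
    intro i
    fin_cases i
    · simp
    · simp only [Fin.mk_one, Matrix.cons_val_one, Matrix.cons_val_zero]
      compute_degree
    · simp only [Fin.reduceFinMk, Matrix.cons_val]
      compute_degree)
  simpa [restrictLine] using this

lemma mem_degreeBox {a : Fin 3 → ℕ} {P : MvPolynomial (Fin 3) K} :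
    P ∈ degreeBox K a ↔ ∀ i, P.degreeOf i ≤ a i := by
  simp only [degreeBox, mem_restrictSupport_iff, degreeOf_le_iff]
  constructor
  · intro h i m hm
    exact h hm i
  · intro h m hm i
    exact h i m hm

lemma mul_mem_degreeBox {a b : Fin 3 → ℕ} {P Q : MvPolynomial (Fin 3) K}
    (hP : P ∈ degreeBox K a) (hQ : Q ∈ degreeBox K b) : P * Q ∈ degreeBox K (a + b) := by
  rw [mem_degreeBox] at *
  intro i
  exact (degreeOf_mul_le i P Q).trans (add_le_add (hP i) (hQ i))

lemma degreeBox_mono {a b : Fin 3 → ℕ} (h : a ≤ b) : degreeBox K a ≤ degreeBox K b :=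
  fun _ hP => mem_degreeBox.2 fun i => (mem_degreeBox.1 hP i).trans (h i)

lemma natCard_degreeBox_support (a : Fin 3 → ℕ) :
    Nat.card {f : Fin 3 →₀ ℕ | ∀ i, f i ≤ a i} = ∏ i, (a i + 1) := by
  have e : {f : Fin 3 →₀ ℕ | ∀ i, f i ≤ a i} ≃ ((Finset.Iic a : Finset (Fin 3 → ℕ)) : Type) :=
    Finsupp.equivFunOnFinite.subtypeEquiv (by
      intro f
      simp [Pi.le_def])
  rw [Nat.card_congr e, Nat.card_eq_fintype_card, Fintype.card_coe, Pi.card_Iic]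
  simp

lemma finrank_degreeBox (a : Fin 3 → ℕ) :
    Module.finrank K (degreeBox K a) = ∏ i, (a i + 1) := by
  rw [← natCard_degreeBox_support]
  exact Module.finrank_eq_nat_card_basis (basisRestrictSupport K {f : Fin 3 →₀ ℕ | ∀ i, f i ≤ a i})

instance finiteDimensional_degreeBox (a : Fin 3 → ℕ) : FiniteDimensional K (degreeBox K a) := by
  apply Module.finite_of_finrank_pos
  rw [finrank_degreeBox]
  positivity

/-- A polynomial of degree at most one in each variable, vanishing on the line of `q'` but not on
the line of `q`. -/
lemma exists_separating {q q' : K × K × K} (h : q ≠ q') :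
    ∃ g ∈ degreeBox K (fun _ => 1), restrictLine q' g = 0 ∧ restrictLine q g ≠ 0 := by
  have hX : ∀ i, (X i : MvPolynomial (Fin 3) K) ∈ degreeBox K (fun _ => 1) := by
    intro i
    rw [mem_degreeBox]
    intro j
    rw [degreeOf_X]
    split_ifs <;> simp
  have hC : ∀ c : K, (C c : MvPolynomial (Fin 3) K) ∈ degreeBox K (fun _ => 1) := by
    intro c
    rw [mem_degreeBox]
    intro j
    simp
  have hCX : ∀ (c : K) i, (C c * X i : MvPolynomial (Fin 3) K) ∈ degreeBox K (fun _ => 1) := by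
    intro c i
    rw [← smul_eq_C_mul]
    exact Submodule.smul_mem _ _ (hX i)
  obtain ⟨x, y, z⟩ := q
  obtain ⟨x', y', z'⟩ := q'
  by_cases hxy : x = x' ∧ y = y'
  · obtain ⟨rfl, rfl⟩ := hxy
    refine ⟨X 2 - C (z' - x * y) - C (x ^ 2) * X 0,
      Submodule.sub_mem _ (Submodule.sub_mem _ (hX _) (hC _)) (hCX _ _), ?_, ?_⟩
    · simp [restrictLine]
    · intro h0
      apply h
      have := congrArg (Polynomial.eval 0) h0
      simp [restrictLine] at this
      have hz : z = z' := by linear_combination this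
      rw [hz]
  · refine ⟨X 1 - C y' + C x' * X 0,
      Submodule.add_mem _ (Submodule.sub_mem _ (hX _) (hC _)) (hCX _ _), ?_, ?_⟩
    · simp [restrictLine]
    · intro h0
      apply hxy
      have h1 := congrArg (Polynomial.eval 0) h0
      have h2 := congrArg (Polynomial.eval 1) h0
      simp [restrictLine] at h1 h2
      constructor
      · linear_combination h1 - h2
      · linear_combination h1

lemma exists_separating_finset (V : Finset (K × K × K)) (q : K × K × K) (hq : q ∉ V) :
    ∃ g ∈ degreeBox K (fun _ => V.card), (∀ q' ∈ V, restrictLine q' g = 0) ∧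
      restrictLine q g ≠ 0 := by
  induction V using Finset.induction_on with
  | empty =>
    refine ⟨1, ?_, by simp, by simp⟩
    rw [mem_degreeBox]
    intro i
    simp
  | insert a s ha ih =>
    simp only [Finset.mem_insert, not_or] at hq
    obtain ⟨g, hg, hg0, hg1⟩ := ih hq.2
    obtain ⟨f, hf, hf0, hf1⟩ := exists_separating hq.1
    refine ⟨g * f, ?_, ?_, ?_⟩
    · rw [Finset.card_insert_of_notMem ha]
      exact mul_mem_degreeBox hg hf
    · intro q' hq'
      rw [map_mul]
      rcases Finset.mem_insert.1 hq' with rfl | hq'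
      · rw [hf0, mul_zero]
      · rw [hg0 q' hq', zero_mul]
    · rw [map_mul]
      exact mul_ne_zero hg1 hf1

/-- A Bézout bound for the number of lines in the intersection of two surfaces. -/
theorem card_le_of_restrictLine_eq_zero {P R : MvPolynomial (Fin 3) K} (hP : Irreducible P)
    (hR : ¬ P ∣ R) (V : Finset (K × K × K)) (hVP : ∀ q ∈ V, restrictLine q P = 0)
    (hVR : ∀ q ∈ V, restrictLine q R = 0) :
    V.card ≤ 2 * P.totalDegree * R.totalDegree := by
  have hP0 : P ≠ 0 := hP.ne_zero
  have hR0 : R ≠ 0 := by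
    rintro rfl
    exact hR (dvd_zero _)
  set m : Fin 3 → ℕ := fun i => P.degreeOf i with hm
  set n : Fin 3 → ℕ := fun i => R.degreeOf i with hn
  set N := V.card with hN
  suffices h : N ≤ m 1 * n 2 + m 2 * n 1 by
    have h1 : m 1 * n 2 ≤ P.totalDegree * R.totalDegree :=
      Nat.mul_le_mul (degreeOf_le_totalDegree _ _) (degreeOf_le_totalDegree _ _)
    have h2 : m 2 * n 1 ≤ P.totalDegree * R.totalDegree :=
      Nat.mul_le_mul (degreeOf_le_totalDegree _ _) (degreeOf_le_totalDegree _ _)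
    nlinarith
  have key : ∀ E : ℕ, N * (E + 1)
      + ((E + N + n 0 + 1) * (N + n 1 + 1) * (N + n 2 + 1)
        + (E + N + m 0 + 1) * (N + m 1 + 1) * (N + m 2 + 1))
      ≤ (E + N + 1) * (N + 1) * (N + 1)
        + (E + N + m 0 + n 0 + 1) * (N + m 1 + n 1 + 1) * (N + m 2 + n 2 + 1) := by
    intro E
    choose! h hbox hzero hne using fun (q : K × K × K) (hq : q ∈ V) =>
      exists_separating_finset (V.erase q) q (Finset.notMem_erase q V)
    set c : Fin 3 → ℕ := ![E + N, N, N] with hc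
    let Φ : (V → Fin (E + 1) → K) × (degreeBox K (c + n) × degreeBox K (c + m)) →ₗ[K]
        MvPolynomial (Fin 3) K :=
      LinearMap.coprod
        (∑ q : V, ∑ r : Fin (E + 1),
          (LinearMap.toSpanSingleton K (MvPolynomial (Fin 3) K) (h q * X 0 ^ (r : ℕ))) ∘ₗ
            (LinearMap.proj r ∘ₗ LinearMap.proj q))
        (LinearMap.coprod (LinearMap.mulLeft K P ∘ₗ (degreeBox K (c + n)).subtype)
          (LinearMap.mulLeft K R ∘ₗ (degreeBox K (c + m)).subtype))
    have hΦ : ∀ f A B, Φ (f, A, B) =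
        (∑ q : V, ∑ r : Fin (E + 1), f q r • (h q * X 0 ^ (r : ℕ))) + (P * A + R * B) := by
      intro f A B
      simp [Φ]
    have hPbox : P ∈ degreeBox K m := mem_degreeBox.2 fun i => le_rfl
    have hRbox : R ∈ degreeBox K n := mem_degreeBox.2 fun i => le_rfl
    let Ψ : degreeBox K c →ₗ[K]
        (V → Fin (E + 1) → K) × (degreeBox K (c + n) × degreeBox K (c + m)) :=
      LinearMap.prod 0 (LinearMap.prod
        ((LinearMap.mulLeft K (-R) ∘ₗ (degreeBox K c).subtype).codRestrict _ (by
          intro x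
          have := mul_mem_degreeBox x.2 (Submodule.neg_mem _ hRbox)
          rwa [mul_comm] at this))
        ((LinearMap.mulLeft K P ∘ₗ (degreeBox K c).subtype).codRestrict _ (by
          intro x
          have := mul_mem_degreeBox x.2 hPbox
          rwa [mul_comm] at this)))
    have hrange : LinearMap.range Φ ≤ degreeBox K (c + m + n) := by
      rintro _ ⟨⟨f, A, B⟩, rfl⟩
      rw [hΦ]
      refine Submodule.add_mem _ ?_ (Submodule.add_mem _ ?_ ?_)
      · refine Submodule.sum_mem _ fun q _ => Submodule.sum_mem _ fun r _ =>
          Submodule.smul_mem _ _ ?_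
        have hX : (X 0 ^ (r : ℕ) : MvPolynomial (Fin 3) K) ∈ degreeBox K ![E, 0, 0] := by
          rw [mem_degreeBox]
          intro i
          refine (degreeOf_pow_le _ _ _).trans ?_
          rw [degreeOf_X]
          have := r.2
          fin_cases i <;> simp
          omega
        refine degreeBox_mono ?_ (mul_mem_degreeBox (hbox q q.2) hX)
        have hcard : (V.erase (q : K × K × K)).card ≤ N :=
          Finset.card_le_card (Finset.erase_subset _ _)
        intro i
        fin_cases i <;> simp [hc] <;> omega
      · have := mul_mem_degreeBox A.2 hPbox
        rw [mul_comm] at this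
        convert this using 2
        abel
      · have := mul_mem_degreeBox B.2 hRbox
        rwa [mul_comm] at this
    have hker : LinearMap.ker Φ ≤ LinearMap.range Ψ := by
      rintro ⟨f, A, B⟩ hfAB
      rw [LinearMap.mem_ker, hΦ] at hfAB
      have hf : f = 0 := by
        funext q r
        have h1 := congrArg (restrictLine (q : K × K × K)) hfAB
        have hX : restrictLine (q : K × K × K) (X 0) = Polynomial.X := by simp [restrictLine]
        simp only [map_add, map_mul, map_sum, map_smul, hVP q q.2, hVR q q.2, zero_mul, add_zero,
          map_zero, map_pow, hX] at h1
        rw [Finset.sum_eq_single q] at h1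
        · have h2 : restrictLine (q : K × K × K) (h q) *
              ∑ r : Fin (E + 1), f q r • (Polynomial.X : Polynomial K) ^ (r : ℕ) = 0 := by
            rw [Finset.mul_sum, ← h1]
            exact Finset.sum_congr rfl fun r _ => by rw [mul_smul_comm]
          have h3 := (mul_eq_zero.1 h2).resolve_left (hne q q.2)
          have h4 := congrArg (fun g => Polynomial.coeff g (r : ℕ)) h3
          simp only [Polynomial.finsetSum_coeff, Polynomial.coeff_smul, Polynomial.coeff_X_pow,
            Polynomial.coeff_zero, smul_eq_mul] at h4
          rw [Finset.sum_eq_single r] at h4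
          · simpa using h4
          · intro b _ hb
            rw [if_neg, mul_zero]
            exact fun h => hb (Fin.ext h.symm)
          · simp
        · intro q' _ hq'
          refine Finset.sum_eq_zero fun r _ => ?_
          rw [hzero q' q'.2 q (Finset.mem_erase.2 ⟨fun h => hq' (Subtype.ext h.symm), q.2⟩)]
          simp
        · simp
      subst hf
      simp only [Pi.zero_apply, zero_smul, Finset.sum_const_zero, zero_add] at hfAB
      have hdvd : P ∣ (B : MvPolynomial (Fin 3) K) := by
        refine (hP.prime.dvd_or_dvd (a := R) (b := B) ⟨-A, ?_⟩).resolve_left hR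
        linear_combination hfAB
      obtain ⟨D, hD⟩ := hdvd
      have hA : (A : MvPolynomial (Fin 3) K) = -R * D := by
        apply mul_left_cancel₀ hP0
        rw [hD] at hfAB
        linear_combination hfAB
      have hDbox : D ∈ degreeBox K c := by
        rw [mem_degreeBox]
        intro i
        by_cases hD0 : D = 0
        · simp [hD0]
        have h1 := mem_degreeBox.1 B.2 i
        rw [hD, degreeOf_mul_eq hP0 hD0] at h1
        simp only [Pi.add_apply, hm] at h1
        omega
      exact ⟨⟨D, hDbox⟩, Prod.ext rfl (Prod.ext (Subtype.ext hA.symm) (Subtype.ext hD.symm))⟩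
    have h1 := LinearMap.finrank_range_add_finrank_ker Φ
    have h2 := Submodule.finrank_mono hrange
    have h3 := Submodule.finrank_mono hker
    have h4 := LinearMap.finrank_range_le Ψ
    rw [finrank_degreeBox] at h2 h4
    simp only [Module.finrank_prod, finrank_degreeBox, Module.finrank_pi_fintype,
      Module.finrank_self, Fin.prod_univ_three, Pi.add_apply] at h1 h2 h4
    simp [hc] at h1 h2 h4
    rw [← hN] at h1
    linarith
  by_contra! hlt
  set μ := m 1 * n 2 + m 2 * n 1 with hμ
  set T := (N + n 0) * (N + n 1 + 1) * (N + n 2 + 1) + N * (N + 1) * (N + 1)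
    + (N + m 0 + n 0) * (N + m 1 + n 1 + 1) * (N + m 2 + n 2 + 1) with hT
  have hk := key T
  have h1 : (μ + 1) * (T + 1) ≤ N * (T + 1) := Nat.mul_le_mul_right _ hlt
  have h2 : (T + 1) * ((N + m 1 + n 1 + 1) * (N + m 2 + n 2 + 1) + (N + 1) * (N + 1)) =
      (T + 1) * ((N + n 1 + 1) * (N + n 2 + 1) + (N + m 1 + 1) * (N + m 2 + 1) + μ) := by
    rw [hμ]
    ring
  nlinarith [Nat.zero_le ((N + n 0) * (N + n 1 + 1) * (N + n 2 + 1)),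
    Nat.zero_le ((N + m 0) * (N + m 1 + 1) * (N + m 2 + 1))]

end Bezout

/-- The lines attached to `q` and `q'` meet in exactly one point. -/
def LinesMeet {K : Type*} [Field K] (q q' : K × K × K) : Prop :=
  q.1 ≠ q'.1 ∧ q.1 * q'.2.1 - q'.1 * q.2.1 + (q'.2.2 - q.2.2) = 0

/-- The first coordinate of the intersection point of the lines attached to `q` and `q'`. -/
noncomputable def meetParam {K : Type*} [Field K] (q q' : K × K × K) : K :=
  (q.2.1 - q'.2.1) / (q.1 - q'.1)

/-- The members of `V` whose lines meet the line of `q`. -/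
noncomputable def meetNbrs {K : Type*} [Field K] (V : Finset (K × K × K)) (q : K × K × K) :
    Finset (K × K × K) :=
  V.filter (LinesMeet q)

/-- No three lines attached to members of `V` meet pairwise. -/
def TriangleFree {K : Type*} [Field K] (V : Finset (K × K × K)) : Prop :=
  ∀ q ∈ V, ∀ q' ∈ V, ∀ q'' ∈ V, LinesMeet q q' → LinesMeet q q'' → ¬ LinesMeet q' q''

section Interpolation

open MvPolynomial

variable {K : Type*} [Field K]

lemma LinesMeet.symm {q q' : K × K × K} (h : LinesMeet q q') : LinesMeet q' q :=
  ⟨h.1.symm, by linear_combination -h.2⟩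

lemma eval_restrictLine (q : K × K × K) (P : MvPolynomial (Fin 3) K) (s : K) :
    (restrictLine q P).eval s =
      MvPolynomial.eval ![s, q.2.1 - q.1 * s, q.2.2 - q.1 * q.2.1 + q.1 ^ 2 * s] P := by
  have h : (Polynomial.evalRingHom s).comp (restrictLine q : MvPolynomial (Fin 3) K →+* _) =
      MvPolynomial.eval ![s, q.2.1 - q.1 * s, q.2.2 - q.1 * q.2.1 + q.1 ^ 2 * s] := by
    apply MvPolynomial.ringHom_ext
    · intro c
      simp [restrictLine]
    · intro i
      fin_cases i <;> simp [restrictLine]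
  exact congrArg (fun f => f P) h

lemma LinesMeet.snd_sub {q q' : K × K × K} (h : LinesMeet q q') :
    q.2.1 - q'.2.1 = (q.1 - q'.1) * meetParam q q' := by
  rw [meetParam, mul_div_cancel₀ _ (sub_ne_zero.2 h.1)]

lemma LinesMeet.trd_sub {q q' : K × K × K} (h : LinesMeet q q') :
    q.2.2 - q.1 * q.2.1 + q.1 ^ 2 * meetParam q q' =
      q'.2.2 - q'.1 * q'.2.1 + q'.1 ^ 2 * meetParam q q' := by
  linear_combination -h.2 - (q.1 + q'.1) * h.snd_sub

lemma LinesMeet.eval_eq {q q' : K × K × K} (h : LinesMeet q q') (P : MvPolynomial (Fin 3) K) :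
    (restrictLine q P).eval (meetParam q q') = (restrictLine q' P).eval (meetParam q q') := by
  rw [eval_restrictLine, eval_restrictLine, h.trd_sub]
  have h2 : q.2.1 - q.1 * meetParam q q' = q'.2.1 - q'.1 * meetParam q q' := by
    linear_combination h.snd_sub
  rw [h2]

lemma TriangleFree.mono {V W : Finset (K × K × K)} (h : TriangleFree W) (hVW : V ⊆ W) :
    TriangleFree V :=
  fun q hq q' hq' q'' hq'' => h q (hVW hq) q' (hVW hq') q'' (hVW hq'')

lemma TriangleFree.injOn_meetParam {V : Finset (K × K × K)} (h : TriangleFree V)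
    {q : K × K × K} (hq : q ∈ V) : Set.InjOn (meetParam q) (meetNbrs V q) := by
  intro q' hq' q'' hq'' hs
  simp only [meetNbrs, Finset.coe_filter, Set.mem_ofPred_eq] at hq' hq''
  have a1 := hq'.2.snd_sub
  have a2 := hq'.2.trd_sub
  have b1 := hq''.2.snd_sub
  have b2 := hq''.2.trd_sub
  rw [← hs] at b1 b2
  by_contra hne
  refine h q hq q' hq'.1 q'' hq''.1 hq'.2 hq''.2 ⟨?_, ?_⟩
  · intro hx
    apply hne
    have hy : q'.2.1 = q''.2.1 := by
      rw [← hx] at b1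
      linear_combination b1 - a1
    rw [← hx, ← hy] at b2
    have hz : q'.2.2 = q''.2.2 := by linear_combination b2 - a2
    exact Prod.ext hx (Prod.ext hy hz)
  · linear_combination a2 - b2 + (q'.1 + q''.1) * (a1 - b1)

/-- A polynomial vanishing on more lines meeting a given line than its degree vanishes on that
line. -/
lemma TriangleFree.card_meetNbrs_le {V W : Finset (K × K × K)} (h : TriangleFree V)
    {q : K × K × K} (hq : q ∈ V) {P : MvPolynomial (Fin 3) K} (hP : restrictLine q P ≠ 0)
    (hW : W ⊆ meetNbrs V q)
    (hWP : ∀ q' ∈ W, (restrictLine q P).eval (meetParam q q') = 0) :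
    W.card ≤ P.totalDegree := by
  refine le_trans ?_ (natDegree_restrictLine_le q P)
  rw [← Finset.card_image_of_injOn ((h.injOn_meetParam hq).mono (Finset.coe_subset.2 hW))]
  refine le_trans (Finset.card_le_card ?_)
    ((Multiset.toFinset_card_le _).trans (Polynomial.card_roots' (restrictLine q P)))
  intro s hs
  obtain ⟨q', hm, rfl⟩ := Finset.mem_image.1 hs
  rw [Multiset.mem_toFinset, Polynomial.mem_roots hP]
  exact hWP q' hm

/-- The method of conditional expectations for a random subset with independent inclusions of
probability `p`. -/
lemma exists_subset_sum_prod_le {ι κ : Type*} (Q : Finset ι) (I : Finset κ) (g : ι → κ → ℝ)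
    (a p : ℝ) (hp0 : 0 ≤ p) (hp1 : p ≤ 1) (w : κ → ℝ) :
    ∃ S ⊆ Q, a * S.card + ∑ q ∈ I, w q * ∏ u ∈ S, g u q ≤
      a * p * Q.card + ∑ q ∈ I, w q * ∏ u ∈ Q, (1 - p + p * g u q) := by
  induction Q using Finset.induction_on generalizing w with
  | empty => exact ⟨∅, subset_rfl, by simp⟩
  | insert u Q hu ih =>
    obtain ⟨S₁, hS₁, h₁⟩ := ih w
    obtain ⟨S₂, hS₂, h₂⟩ := ih fun q => w q * g u q
    set r₁ := ∑ q ∈ I, w q * ∏ u ∈ Q, (1 - p + p * g u q) with hr₁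
    set r₂ := ∑ q ∈ I, w q * g u q * ∏ u ∈ Q, (1 - p + p * g u q) with hr₂
    have hR : ∑ q ∈ I, w q * ∏ v ∈ insert u Q, (1 - p + p * g v q) = (1 - p) * r₁ + p * r₂ := by
      rw [hr₁, hr₂, Finset.mul_sum, Finset.mul_sum, ← Finset.sum_add_distrib]
      refine Finset.sum_congr rfl fun q _ => ?_
      rw [Finset.prod_insert hu]
      ring
    rw [hR, Finset.card_insert_of_notMem hu]
    push_cast
    by_cases hc : r₁ ≤ a * p + ((1 - p) * r₁ + p * r₂)
    · exact ⟨S₁, hS₁.trans (Finset.subset_insert _ _), by linarith⟩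
    · refine ⟨insert u S₂, Finset.insert_subset_insert _ hS₂, ?_⟩
      have huS : u ∉ S₂ := fun h => hu (hS₂ h)
      rw [Finset.card_insert_of_notMem huS]
      have hS : ∑ q ∈ I, w q * ∏ v ∈ insert u S₂, g v q =
          ∑ q ∈ I, w q * g u q * ∏ v ∈ S₂, g v q :=
        Finset.sum_congr rfl fun q _ => by rw [Finset.prod_insert huS]; ring
      rw [hS]
      push_cast
      have hp : a + r₂ ≤ r₁ := by
        by_contra! hlt
        nlinarith
      nlinarith

/-- Lines in `S` are imposed directly; the other lines of `V` need only as many conditions as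
`S` does not already provide. -/
lemma exists_ne_zero_restrictLine_eq_zero_of_card_lt [Infinite K] {V S : Finset (K × K × K)}
    (hV : TriangleFree V) (hS : S ⊆ V) (j : ℕ)
    (hcard : S.card * (3 * j + 1) + ∑ q ∈ V, (3 * j + 1 - (meetNbrs S q).card) < (j + 1) ^ 3) :
    ∃ P : MvPolynomial (Fin 3) K, P ≠ 0 ∧ P.totalDegree ≤ 3 * j ∧
      ∀ q ∈ V, restrictLine q P = 0 := by
  have hpts : ∀ q : K × K × K, ∃ T : Finset K,
      T.card = 3 * j + 1 - (meetNbrs S q).card ∧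
        Disjoint T ((meetNbrs S q).image (meetParam q)) := by
    intro q
    obtain ⟨T, hT, hTc⟩ := (Finset.finite_toSet ((meetNbrs S q).image
      (meetParam q))).infinite_compl.exists_subset_card_eq (3 * j + 1 - (meetNbrs S q).card)
    refine ⟨T, hTc, Finset.disjoint_left.2 fun x hx hx' => hT hx hx'⟩
  choose T hTc hTd using hpts
  let Φ : degreeBox K (fun _ => j) →ₗ[K]
      (S → Fin (3 * j + 1) → K) × ((q : V) → T q → K) :=
    LinearMap.prod
      (LinearMap.pi fun q => LinearMap.pi fun r =>
        Polynomial.lcoeff K r ∘ₗ (restrictLine (q : K × K × K)).toLinearMap ∘ₗ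
          (degreeBox K (fun _ => j)).subtype)
      (LinearMap.pi fun q => LinearMap.pi fun s =>
        Polynomial.leval (s : K) ∘ₗ (restrictLine (q : K × K × K)).toLinearMap ∘ₗ
          (degreeBox K (fun _ => j)).subtype)
  have hker : LinearMap.ker Φ ≠ ⊥ := by
    apply LinearMap.ker_ne_bot_of_finrank_lt
    rw [finrank_degreeBox]
    simp only [Module.finrank_prod, Module.finrank_pi_fintype, Module.finrank_self,
      Finset.sum_const, Finset.card_univ, Fintype.card_coe, Fintype.card_fin, smul_eq_mul, mul_one,
      Finset.prod_const, hTc]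
    rwa [Finset.sum_coe_sort V (fun q => 3 * j + 1 - (meetNbrs S q).card)]
  obtain ⟨P, hPk, hP0⟩ := Submodule.exists_mem_ne_zero_of_ne_bot hker
  have hdeg : (P : MvPolynomial (Fin 3) K).totalDegree ≤ 3 * j := by
    refine Finset.sup_le fun m hm => ?_
    have hm' : ∀ i, m i ≤ j := fun i => degreeOf_le_iff.1 (mem_degreeBox.1 P.2 i) m hm
    rw [Finsupp.sum_fintype _ _ fun _ => rfl, Fin.sum_univ_three]
    linarith [hm' 0, hm' 1, hm' 2]
  have h1 : ∀ q ∈ S, restrictLine q (P : MvPolynomial (Fin 3) K) = 0 := by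
    intro q hq
    ext r
    by_cases hr : r < 3 * j + 1
    · exact congrFun (congrFun (congrArg Prod.fst hPk) ⟨q, hq⟩) ⟨r, hr⟩
    · exact Polynomial.coeff_eq_zero_of_natDegree_lt
        ((natDegree_restrictLine_le _ _).trans_lt (by omega))
  refine ⟨P, fun h => hP0 (Subtype.ext h), hdeg, fun q hq => ?_⟩
  by_contra hne
  have hinj : Set.InjOn (meetParam q) (meetNbrs S q) := (hV.injOn_meetParam hq).mono
    (Finset.coe_subset.2 (Finset.filter_subset_filter (LinesMeet q) hS))
  have hroots : T q ∪ (meetNbrs S q).image (meetParam q) ⊆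
      (restrictLine q (P : MvPolynomial (Fin 3) K)).roots.toFinset := by
    intro s hs
    rw [Multiset.mem_toFinset, Polynomial.mem_roots hne]
    rcases Finset.mem_union.1 hs with hs | hs
    · exact congrFun (congrFun (congrArg Prod.snd hPk) ⟨q, hq⟩) ⟨s, hs⟩
    · obtain ⟨q', hq', rfl⟩ := Finset.mem_image.1 hs
      have hq' := Finset.mem_filter.1 hq'
      rw [Polynomial.IsRoot, hq'.2.eval_eq, h1 q' hq'.1, Polynomial.eval_zero]
  have h2 := (Finset.card_le_card hroots).trans
    ((Multiset.toFinset_card_le _).trans (Polynomial.card_roots' _))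
  rw [Finset.card_union_of_disjoint (hTd q), hTc, Finset.card_image_of_injOn hinj] at h2
  have := natDegree_restrictLine_le q (P : MvPolynomial (Fin 3) K)
  omega

lemma exists_ne_zero_restrictLine_eq_zero [Infinite K] {V : Finset (K × K × K)}
    (hV : TriangleFree V) {D : ℝ} (hdeg : ∀ q ∈ V, D ≤ (meetNbrs V q).card) (j : ℕ)
    (h1 : 12 * ((j : ℝ) + 1) ≤ D) (h2 : 72 * (V.card : ℝ) ≤ (j + 1) * D)
    (h3 : 2 * (V.card : ℝ) < (j + 1) ^ 3) :
    ∃ P : MvPolynomial (Fin 3) K, P ≠ 0 ∧ P.totalDegree ≤ 3 * j ∧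
      ∀ q ∈ V, restrictLine q P = 0 := by
  have hj : (0 : ℝ) < j + 1 := by positivity
  have hD : 0 < D := by linarith
  set p : ℝ := 4 * (3 * j + 1) / D with hp
  have hpD : p * D = 4 * (3 * j + 1) := div_mul_cancel₀ _ hD.ne'
  have hp0 : 0 ≤ p := by positivity
  have hp1 : p ≤ 1 := by
    rw [hp, div_le_one hD]
    linarith
  obtain ⟨S, hS, hsum⟩ := exists_subset_sum_prod_le V V
    (fun u q => if LinesMeet q u then 1 / 2 else 1) (3 * (j : ℝ) + 1) p hp0 hp1
    (fun _ => 2 ^ (3 * j + 1))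
  apply exists_ne_zero_restrictLine_eq_zero_of_card_lt hV hS j
  have hleft : ((S.card * (3 * j + 1) + ∑ q ∈ V, (3 * j + 1 - (meetNbrs S q).card) : ℕ) : ℝ) ≤
      (3 * (j : ℝ) + 1) * S.card + ∑ q ∈ V, 2 ^ (3 * j + 1) *
        ∏ u ∈ S, (if LinesMeet q u then 1 / 2 else 1 : ℝ) := by
    push_cast
    rw [mul_comm]
    gcongr with q hq
    rw [Finset.prod_ite, Finset.prod_const, Finset.prod_const_one, mul_one]
    change _ ≤ (2 : ℝ) ^ (3 * j + 1) * (1 / 2) ^ (meetNbrs S q).card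
    set x := (meetNbrs S q).card
    rcases le_total x (3 * j + 1) with hx | hx
    · obtain ⟨y, hy⟩ := Nat.exists_eq_add_of_le hx
      rw [hy, Nat.add_sub_cancel_left, pow_add, one_div, inv_pow, mul_comm ((2 : ℝ) ^ x),
        mul_assoc, mul_inv_cancel₀ (by positivity), mul_one]
      exact_mod_cast Nat.lt_two_pow_self.le
    · rw [Nat.sub_eq_zero_of_le hx]
      simp only [Nat.cast_zero]
      positivity
  have hright : ∑ q ∈ V, (2 : ℝ) ^ (3 * j + 1) *
      ∏ u ∈ V, (1 - p + p * (if LinesMeet q u then 1 / 2 else 1 : ℝ)) ≤ V.card := by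
    rw [Finset.card_eq_sum_ones]
    push_cast
    refine Finset.sum_le_sum fun q hq => ?_
    have e1 : ∏ u ∈ V, (1 - p + p * (if LinesMeet q u then 1 / 2 else 1 : ℝ)) =
        (1 - p / 2) ^ (meetNbrs V q).card := by
      rw [meetNbrs, ← Finset.prod_const, Finset.prod_filter]
      refine Finset.prod_congr rfl fun u _ => ?_
      split_ifs <;> ring
    have e2 : (1 - p / 2) ^ (meetNbrs V q).card ≤ Real.exp (-2 * (3 * j + 1)) := by
      calc (1 - p / 2) ^ (meetNbrs V q).card ≤ Real.exp (-(p / 2)) ^ (meetNbrs V q).card := by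
            gcongr
            · linarith
            · linarith [Real.add_one_le_exp (-(p / 2))]
        _ = Real.exp (-(p / 2) * (meetNbrs V q).card) := by rw [mul_comm, Real.exp_nat_mul]
        _ ≤ Real.exp (-2 * (3 * j + 1)) := by
            apply Real.exp_le_exp.2
            nlinarith [hdeg q hq]
    have e3 : Real.exp (-2 * (3 * j + 1)) = Real.exp (-2) ^ (3 * j + 1) := by
      rw [← Real.exp_nat_mul]
      push_cast
      ring_nf
    have e4 : 2 * Real.exp (-2) ≤ 1 := by
      have h := Real.add_one_le_exp (2 : ℝ)
      rw [Real.exp_neg]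
      rw [← div_eq_mul_inv, div_le_one (Real.exp_pos _)]
      linarith
    calc (2 : ℝ) ^ (3 * j + 1) * ∏ u ∈ V, (1 - p + p * (if LinesMeet q u then 1 / 2 else 1 : ℝ))
        ≤ 2 ^ (3 * j + 1) * Real.exp (-2) ^ (3 * j + 1) := by
          rw [e1, ← e3]
          gcongr
      _ = (2 * Real.exp (-2)) ^ (3 * j + 1) := by rw [mul_pow]
      _ ≤ 1 := pow_le_one₀ (by positivity) e4
  have hmid : (3 * (j : ℝ) + 1) * p * V.card ≤ (j + 1) ^ 3 / 2 := by
    have : (3 * (j : ℝ) + 1) * p * V.card = 4 * (3 * j + 1) ^ 2 * V.card / D := by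
      rw [hp]
      ring
    rw [this, div_le_iff₀ hD]
    have h4 : (3 * (j : ℝ) + 1) ^ 2 ≤ 9 * (j + 1) ^ 2 := by
      nlinarith [(Nat.cast_nonneg j : (0 : ℝ) ≤ j)]
    calc 4 * (3 * (j : ℝ) + 1) ^ 2 * (V.card : ℝ)
        ≤ 4 * (9 * ((j : ℝ) + 1) ^ 2) * (V.card : ℝ) := by gcongr
      _ = ((j : ℝ) + 1) ^ 2 / 2 * (72 * (V.card : ℝ)) := by ring
      _ ≤ ((j : ℝ) + 1) ^ 2 / 2 * (((j : ℝ) + 1) * D) := by gcongr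
      _ = _ := by ring
  have : ((S.card * (3 * j + 1) + ∑ q ∈ V, (3 * j + 1 - (meetNbrs S q).card) : ℕ) : ℝ) <
      (((j + 1) ^ 3 : ℕ) : ℝ) := by
    push_cast at hleft ⊢
    linarith
  exact_mod_cast this

end Interpolation

section SecondOrder

open MvPolynomial

variable {K : Type*} [Field K]

lemma MvPolynomial.pderiv_comm {σ R : Type*} [CommRing R] (i j : σ) (P : MvPolynomial σ R) :
    pderiv i (pderiv j P) = pderiv j (pderiv i P) := by
  have h : ⁅pderiv (R := R) i, pderiv (R := R) j⁆ = 0 := by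
    apply derivation_ext
    intro k
    rw [Derivation.commutator_apply, pderiv_X, pderiv_X]
    simp [Pi.single_apply, apply_ite (pderiv (R := R) i), apply_ite (pderiv (R := R) j)]
  have := congrArg (fun D : Derivation R (MvPolynomial σ R) (MvPolynomial σ R) => D P) h
  simpa [Derivation.commutator_apply, sub_eq_zero] using this

lemma MvPolynomial.totalDegree_pderiv_le {σ R : Type*} [CommRing R] (i : σ)
    (P : MvPolynomial σ R) : (pderiv i P).totalDegree ≤ P.totalDegree - 1 := by
  refine Finset.sup_le fun m hm => ?_
  have h : m + Finsupp.single i 1 ∈ P.support := by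
    rw [mem_support_iff] at hm ⊢
    intro h0
    rw [coeff_pderiv, h0, zero_mul] at hm
    exact hm rfl
  have := le_totalDegree h
  rw [Finsupp.sum_add_index' (fun _ => rfl) (fun _ _ _ => rfl),
    Finsupp.sum_single_index rfl] at this
  omega

/-- The derivation of polynomials in direction `(1, -x, x ^ 2)`. -/
noncomputable def slopeDeriv (x : K) :
    Derivation K (MvPolynomial (Fin 3) K) (MvPolynomial (Fin 3) K) :=
  pderiv 0 - (C x : MvPolynomial (Fin 3) K) • pderiv 1 +
    (C (x ^ 2) : MvPolynomial (Fin 3) K) • pderiv 2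

/-- The derivation of polynomials in direction `(0, -1, 2 * x)`. -/
noncomputable def turnDeriv (x : K) :
    Derivation K (MvPolynomial (Fin 3) K) (MvPolynomial (Fin 3) K) :=
  -pderiv 1 + (C (2 * x) : MvPolynomial (Fin 3) K) • pderiv 2

lemma slopeDeriv_apply (x : K) (P : MvPolynomial (Fin 3) K) :
    slopeDeriv x P = pderiv 0 P - C x * pderiv 1 P + C x ^ 2 * pderiv 2 P := by
  simp [slopeDeriv]

lemma turnDeriv_apply (x : K) (P : MvPolynomial (Fin 3) K) :
    turnDeriv x P = -pderiv 1 P + 2 * C x * pderiv 2 P := by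
  simp [turnDeriv, map_ofNat]

lemma restrictLine_slopeDeriv (q : K × K × K) (P : MvPolynomial (Fin 3) K) :
    restrictLine q (slopeDeriv q.1 P) = Polynomial.derivative (restrictLine q P) := by
  induction P using MvPolynomial.induction_on with
  | C a => simp [restrictLine]
  | add P Q hP hQ => simp [hP, hQ]
  | mul_X P i hP =>
    rw [Derivation.leibniz, map_add, smul_eq_mul, smul_eq_mul, map_mul, map_mul, hP, map_mul,
      Polynomial.derivative_mul]
    have : restrictLine q (slopeDeriv q.1 (X i)) =
        Polynomial.derivative (restrictLine q (X i)) := by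
      fin_cases i <;> simp [slopeDeriv_apply, restrictLine, pderiv_X, Polynomial.derivative_pow]
    rw [this]
    ring

/-- The coefficients of the pseudo-quotient of the second-order condition on the direction of a line
by the first-order one. -/
noncomputable def quotTwo (P : MvPolynomial (Fin 3) K) : MvPolynomial (Fin 3) K :=
  pderiv 2 P ^ 2 * pderiv 2 (pderiv 2 P)

/-- See `quotTwo`. -/
noncomputable def quotOne (P : MvPolynomial (Fin 3) K) : MvPolynomial (Fin 3) K :=
  pderiv 2 P * (pderiv 2 P * (-2 * pderiv 1 (pderiv 2 P)) + pderiv 1 P * pderiv 2 (pderiv 2 P))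

/-- See `quotTwo`. -/
noncomputable def quotZero (P : MvPolynomial (Fin 3) K) : MvPolynomial (Fin 3) K :=
  pderiv 2 P ^ 2 * (pderiv 1 (pderiv 1 P) + 2 * pderiv 0 (pderiv 2 P)) -
    pderiv 2 P * pderiv 0 P * pderiv 2 (pderiv 2 P) +
    pderiv 1 P * (pderiv 2 P * (-2 * pderiv 1 (pderiv 2 P)) +
      pderiv 1 P * pderiv 2 (pderiv 2 P))

/-- The linear coefficient of the pseudo-remainder of the second-order condition on the direction
of a line by the first-order one. -/
noncomputable def remOne (P : MvPolynomial (Fin 3) K) : MvPolynomial (Fin 3) K :=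
  pderiv 2 P ^ 3 * (-2 * pderiv 0 (pderiv 1 P)) + pderiv 1 P * quotZero P -
    pderiv 0 P * quotOne P

/-- The constant coefficient of the pseudo-remainder, see `remOne`. -/
noncomputable def remZero (P : MvPolynomial (Fin 3) K) : MvPolynomial (Fin 3) K :=
  pderiv 2 P ^ 3 * pderiv 0 (pderiv 0 P) - pderiv 0 P * quotZero P

lemma slopeDeriv_slopeDeriv (x : K) (P : MvPolynomial (Fin 3) K) :
    slopeDeriv x (slopeDeriv x P) = pderiv 0 (pderiv 0 P) + C x * (-2 * pderiv 0 (pderiv 1 P)) +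
      C x ^ 2 * (pderiv 1 (pderiv 1 P) + 2 * pderiv 0 (pderiv 2 P)) +
      C x ^ 3 * (-2 * pderiv 1 (pderiv 2 P)) + C x ^ 4 * pderiv 2 (pderiv 2 P) := by
  simp only [slopeDeriv_apply, ← C_pow, map_add, map_sub, pderiv_C_mul, pderiv_comm (1 : Fin 3) 0,
    pderiv_comm (2 : Fin 3) 0, pderiv_comm (2 : Fin 3) 1]
  simp only [C_pow]
  ring

lemma slopeDeriv_turnDeriv (x : K) (P : MvPolynomial (Fin 3) K) :
    slopeDeriv x (turnDeriv x P) = -pderiv 0 (pderiv 1 P) +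
      C x * (pderiv 1 (pderiv 1 P) + 2 * pderiv 0 (pderiv 2 P)) +
      C x ^ 2 * (-3 * pderiv 1 (pderiv 2 P)) + C x ^ 3 * (2 * pderiv 2 (pderiv 2 P)) := by
  have h : ∀ i Q, pderiv i ((2 : MvPolynomial (Fin 3) K) * C x * Q) = 2 * C x * pderiv i Q := by
    intro i Q
    have := pderiv_C_mul (a := 2 * x) (f := Q) (i := i)
    rwa [C_mul, map_ofNat] at this
  simp only [slopeDeriv_apply, turnDeriv_apply, map_add, map_neg, h, pderiv_comm (2 : Fin 3) 1]
  ring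

lemma turnDeriv_slopeDeriv (x : K) (P : MvPolynomial (Fin 3) K) :
    turnDeriv x (slopeDeriv x P) = slopeDeriv x (turnDeriv x P) := by
  rw [slopeDeriv_turnDeriv]
  simp only [slopeDeriv_apply, turnDeriv_apply, ← C_pow, map_add, map_sub, pderiv_C_mul,
    pderiv_comm (1 : Fin 3) 0, pderiv_comm (2 : Fin 3) 0, pderiv_comm (2 : Fin 3) 1]
  simp only [C_pow]
  ring

lemma pderiv_two_slopeDeriv (x : K) (P : MvPolynomial (Fin 3) K) :
    pderiv 2 (slopeDeriv x P) = slopeDeriv x (pderiv 2 P) := by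
  simp only [slopeDeriv_apply, ← C_pow, map_add, map_sub, pderiv_C_mul,
    pderiv_comm (2 : Fin 3) 0, pderiv_comm (2 : Fin 3) 1]

/-- The pseudo-division of the second-order condition by the first-order one. -/
lemma pseudoDivision (x : K) (P : MvPolynomial (Fin 3) K) :
    pderiv 2 P ^ 3 * slopeDeriv x (slopeDeriv x P) =
      slopeDeriv x P * (quotTwo P * C x ^ 2 + quotOne P * C x + quotZero P) +
        C x * remOne P + remZero P := by
  rw [slopeDeriv_slopeDeriv, slopeDeriv_apply, remOne, remZero, quotTwo, quotOne, quotZero]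
  ring

/-- The derivative of `pseudoDivision` with respect to `x`. -/
lemma pseudoDivision_deriv (x : K) (P : MvPolynomial (Fin 3) K) :
    pderiv 2 P ^ 3 * (2 * slopeDeriv x (turnDeriv x P)) =
      turnDeriv x P * (quotTwo P * C x ^ 2 + quotOne P * C x + quotZero P) +
        slopeDeriv x P * (2 * quotTwo P * C x + quotOne P) + remOne P := by
  rw [slopeDeriv_turnDeriv, slopeDeriv_apply, turnDeriv_apply, remOne, quotTwo, quotOne, quotZero]
  ring

lemma totalDegree_quotOne_le (P : MvPolynomial (Fin 3) K) :
    (quotOne P).totalDegree ≤ 3 * P.totalDegree ∧ (quotZero P).totalDegree ≤ 3 * P.totalDegree ∧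
      (remOne P).totalDegree ≤ 4 * P.totalDegree ∧
      (remZero P).totalDegree ≤ 4 * P.totalDegree := by
  set e := P.totalDegree with he
  have h1 : ∀ i, (pderiv i P).totalDegree ≤ e := fun i =>
    (totalDegree_pderiv_le i P).trans (Nat.sub_le _ _)
  have h2 : ∀ i j, (pderiv i (pderiv j P)).totalDegree ≤ e := fun i j =>
    (totalDegree_pderiv_le i _).trans ((Nat.sub_le _ _).trans (h1 j))
  have hmul : ∀ {Q R : MvPolynomial (Fin 3) K} {a b c : ℕ}, Q.totalDegree ≤ a →
      R.totalDegree ≤ b → a + b = c → (Q * R).totalDegree ≤ c := fun hQ hR hc =>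
    (totalDegree_mul _ _).trans (hc ▸ add_le_add hQ hR)
  have hpow : ∀ {Q : MvPolynomial (Fin 3) K} (n : ℕ), Q.totalDegree ≤ e →
      (Q ^ n).totalDegree ≤ n * e := fun n hQ =>
    (totalDegree_pow _ _).trans (Nat.mul_le_mul_left n hQ)
  have hadd : ∀ {Q R : MvPolynomial (Fin 3) K} {a : ℕ}, Q.totalDegree ≤ a →
      R.totalDegree ≤ a → (Q + R).totalDegree ≤ a := fun hQ hR =>
    (totalDegree_add _ _).trans (max_le hQ hR)
  have hsub : ∀ {Q R : MvPolynomial (Fin 3) K} {a : ℕ}, Q.totalDegree ≤ a →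
      R.totalDegree ≤ a → (Q - R).totalDegree ≤ a := fun hQ hR =>
    (totalDegree_sub _ _).trans (max_le hQ hR)
  have hc : ∀ a : K, (C a : MvPolynomial (Fin 3) K).totalDegree ≤ 0 := fun a => by simp
  have hm2 : (-2 : MvPolynomial (Fin 3) K).totalDegree ≤ 0 := by
    have := hc (-2)
    rwa [map_neg, map_ofNat] at this
  have hp2 : (2 : MvPolynomial (Fin 3) K).totalDegree ≤ 0 := by
    have := hc 2
    rwa [map_ofNat] at this
  have hinner : (pderiv 2 P * (-2 * pderiv 1 (pderiv 2 P)) +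
      pderiv 1 P * pderiv 2 (pderiv 2 P)).totalDegree ≤ 2 * e :=
    hadd (hmul (h1 2) (hmul hm2 (h2 1 2) (zero_add _)) (by ring))
      (hmul (h1 1) (h2 2 2) (by ring))
  have hq1 : (quotOne P).totalDegree ≤ 3 * e := hmul (h1 2) hinner (by ring)
  have hq0 : (quotZero P).totalDegree ≤ 3 * e :=
    hadd (hsub (hmul (hpow 2 (h1 2)) (hadd (h2 1 1) (hmul hp2 (h2 0 2) (zero_add _))) (by ring))
      (hmul (hmul (h1 2) (h1 0) rfl) (h2 2 2) (by ring))) (hmul (h1 1) hinner (by ring))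
  refine ⟨hq1, hq0, ?_, ?_⟩
  · exact hsub (hadd (hmul (hpow 3 (h1 2)) (hmul hm2 (h2 0 1) (zero_add _)) (by ring))
      (hmul (h1 1) hq0 (by ring))) (hmul (h1 0) hq1 (by ring))
  · exact hsub (hmul (hpow 3 (h1 2)) (h2 0 0) (by ring)) (hmul (h1 0) hq0 (by ring))

lemma totalDegree_remOne_le (P : MvPolynomial (Fin 3) K) :
    (remOne P).totalDegree ≤ 4 * P.totalDegree :=
  (totalDegree_quotOne_le P).2.2.1

lemma totalDegree_remZero_le (P : MvPolynomial (Fin 3) K) :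
    (remZero P).totalDegree ≤ 4 * P.totalDegree :=
  (totalDegree_quotOne_le P).2.2.2

end SecondOrder

section Flecnodal

open MvPolynomial

variable {K : Type*} [Field K]

lemma restrictLine_slopeDeriv_eq_zero {q : K × K × K} {P : MvPolynomial (Fin 3) K}
    (h : restrictLine q P = 0) : restrictLine q (slopeDeriv q.1 P) = 0 := by
  rw [restrictLine_slopeDeriv, h, Polynomial.derivative_zero]

/-- At a point where two lines in the surface meet, the second-order condition is divisible by
the first-order one. -/
lemma LinesMeet.eval_rem_eq_zero {q q' : K × K × K} (h : LinesMeet q q')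
    {P : MvPolynomial (Fin 3) K} (hq : restrictLine q P = 0) (hq' : restrictLine q' P = 0) :
    (restrictLine q (remOne P)).eval (meetParam q q') = 0 ∧
      (restrictLine q (remZero P)).eval (meetParam q q') = 0 := by
  have key : ∀ x : K, (restrictLine q (slopeDeriv x P)).eval (meetParam q q') = 0 →
      (restrictLine q (slopeDeriv x (slopeDeriv x P))).eval (meetParam q q') = 0 →
      x * (restrictLine q (remOne P)).eval (meetParam q q') +
        (restrictLine q (remZero P)).eval (meetParam q q') = 0 := by
    intro x h1 h2
    have := congrArg (fun R => (restrictLine q R).eval (meetParam q q')) (pseudoDivision x P)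
    simp only [map_mul, map_add, map_pow, Polynomial.eval_mul, Polynomial.eval_add,
      Polynomial.eval_pow, h1, h2] at this
    have hc : (restrictLine q (C x)).eval (meetParam q q') = x := by simp [restrictLine]
    rw [hc] at this
    linear_combination -this
  have a := key q.1 (by rw [restrictLine_slopeDeriv_eq_zero hq, Polynomial.eval_zero]) (by
    rw [restrictLine_slopeDeriv_eq_zero (restrictLine_slopeDeriv_eq_zero hq),
      Polynomial.eval_zero])
  have b := key q'.1
    (by rw [h.eval_eq, restrictLine_slopeDeriv_eq_zero hq', Polynomial.eval_zero]) (by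
    rw [h.eval_eq, restrictLine_slopeDeriv_eq_zero (restrictLine_slopeDeriv_eq_zero hq'),
      Polynomial.eval_zero])
  have h1 : (restrictLine q (remOne P)).eval (meetParam q q') = 0 := by
    have : (q.1 - q'.1) * (restrictLine q (remOne P)).eval (meetParam q q') = 0 := by
      linear_combination a - b
    exact (mul_eq_zero.1 this).resolve_left (sub_ne_zero.2 h.1)
  refine ⟨h1, ?_⟩
  rw [h1, mul_zero, zero_add] at a
  exact a

/-- At a point where two lines in the surface meet, the slope of the second one is determined by
the tangent plane. -/
lemma LinesMeet.eval_turnDeriv {q q' : K × K × K} (h : LinesMeet q q')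
    {P : MvPolynomial (Fin 3) K} (hq : restrictLine q P = 0) (hq' : restrictLine q' P = 0) :
    -(restrictLine q (turnDeriv q.1 P)).eval (meetParam q q') =
      (q'.1 - q.1) * (restrictLine q (pderiv 2 P)).eval (meetParam q q') := by
  have hc : ∀ x, (restrictLine q (C x)).eval (meetParam q q') = x := by simp [restrictLine]
  have h2 : (restrictLine q 2).eval (meetParam q q') = 2 := by simp [restrictLine]
  have a : (restrictLine q (slopeDeriv q.1 P)).eval (meetParam q q') = 0 := by
    rw [restrictLine_slopeDeriv_eq_zero hq, Polynomial.eval_zero]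
  have b : (restrictLine q (slopeDeriv q'.1 P)).eval (meetParam q q') = 0 := by
    rw [h.eval_eq, restrictLine_slopeDeriv_eq_zero hq', Polynomial.eval_zero]
  simp only [slopeDeriv_apply, turnDeriv_apply, map_add, map_sub, map_mul, map_pow, map_neg,
    Polynomial.eval_add, Polynomial.eval_sub, Polynomial.eval_mul, Polynomial.eval_pow,
    Polynomial.eval_neg, hc, h2] at a b ⊢
  have h0 := sub_ne_zero.2 h.1
  apply mul_left_cancel₀ h0
  linear_combination b - a

/-- The differential equation for the tangent planes along a line in a surface all of whose
points are flecnodal with respect to the given directions. -/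
lemma wronskian_eq_of_dvd_rem {q : K × K × K} {P : MvPolynomial (Fin 3) K}
    (hq : restrictLine q P = 0) (h1 : P ∣ remOne P) (h0 : P ∣ remZero P)
    {A B : Polynomial K} (hA : A = restrictLine q (pderiv 2 P))
    (hB : B = -restrictLine q (turnDeriv q.1 P)) :
    A ^ 3 * B * (B * (B * A.derivative.derivative - A * B.derivative.derivative) -
      2 * B.derivative * (B * A.derivative - A * B.derivative)) = 0 := by
  set x := q.1 with hx
  have hφE : restrictLine q (slopeDeriv x P) = 0 := restrictLine_slopeDeriv_eq_zero hq
  have hφEE : restrictLine q (slopeDeriv x (slopeDeriv x P)) = 0 :=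
    restrictLine_slopeDeriv_eq_zero hφE
  set D : Derivation K (MvPolynomial (Fin 3) K) (MvPolynomial (Fin 3) K) :=
    (pderiv 2 P) ^ 2 • slopeDeriv x - (pderiv 2 P * turnDeriv x P) • turnDeriv x +
      (turnDeriv x P) ^ 2 • pderiv 2 with hD
  have hDapp : ∀ Q, D Q = (pderiv 2 P) ^ 2 * slopeDeriv x Q -
      (pderiv 2 P * turnDeriv x P) * turnDeriv x Q + (turnDeriv x P) ^ 2 * pderiv 2 Q := by
    intro Q
    simp [hD]
  have hDP : restrictLine q (D P) = 0 := by
    rw [hDapp, map_add, map_sub, map_mul, hφE]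
    simp only [map_mul, map_pow]
    ring
  have hDdvd : ∀ R, P ∣ R → restrictLine q (D R) = 0 ∧ restrictLine q R = 0 := by
    rintro _ ⟨S, rfl⟩
    rw [Derivation.leibniz, map_add, smul_eq_mul, smul_eq_mul, map_mul, map_mul, map_mul, hq, hDP]
    simp
  obtain ⟨hD1, hR1⟩ := hDdvd _ h1
  obtain ⟨hD0, -⟩ := hDdvd _ h0
  have hDC : D (C x) = 0 := D.map_algebraMap x
  set k := quotTwo P * C x ^ 2 + quotOne P * C x + quotZero P with hk
  have i1 := congrArg (fun R => restrictLine q (D R)) (pseudoDivision x P)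
  have i2 := congrArg (restrictLine q) (pseudoDivision_deriv x P)
  rw [← hk] at i1 i2
  simp only [map_add, Derivation.leibniz, smul_eq_mul, map_mul, hDC, hφE, hφEE, hD1,
    hD0, hR1, zero_mul, mul_zero, add_zero, zero_add, map_pow] at i1 i2
  have eE : ∀ Q, restrictLine q (slopeDeriv x Q) = Polynomial.derivative (restrictLine q Q) :=
    restrictLine_slopeDeriv q
  have hB' : restrictLine q (turnDeriv x P) = -B := by rw [hB, neg_neg]
  have eDE : restrictLine q (D (slopeDeriv x P)) =
      -(A * B * B.derivative) + B ^ 2 * A.derivative := by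
    simp only [hDapp, map_add, map_sub, map_mul, map_pow, turnDeriv_slopeDeriv,
      pderiv_two_slopeDeriv, eE, ← hA, hB', hq, map_neg, map_zero]
    ring
  have eDEE : restrictLine q (D (slopeDeriv x (slopeDeriv x P))) =
      -(A * B * B.derivative.derivative) + B ^ 2 * A.derivative.derivative := by
    simp only [hDapp, map_add, map_sub, map_mul, map_pow, turnDeriv_slopeDeriv,
      pderiv_two_slopeDeriv, eE, ← hA, hB', hq, map_neg, map_zero]
    ring
  rw [eDE, eDEE, ← hA] at i1
  rw [eE, hB', ← hA] at i2
  have h2 : restrictLine q 2 = 2 := map_ofNat _ 2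
  rw [h2, map_neg] at i2
  linear_combination B * i1 + (-(A * B.derivative) + B * A.derivative) * B * i2

/-- In characteristic zero, or large compared with the degrees, polynomials with vanishing
Wronskian are proportional. -/
lemma Polynomial.exists_eq_C_mul_of_wronskian_eq_zero {n : ℕ}
    (hn : ∀ m : ℕ, 0 < m → m ≤ n → (m : K) ≠ 0)
    {f g : Polynomial K} (hf : f.natDegree ≤ n) (hg : g.natDegree ≤ n) (hg0 : g ≠ 0)
    (h : f.derivative * g = f * g.derivative) : ∃ c : K, f = Polynomial.C c * g := by
  have key : ∀ f : Polynomial K, f.natDegree ≤ n → f ≠ 0 → f.derivative * g = f * g.derivative →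
      f.natDegree = g.natDegree := by
    intro f hf hf0 h
    have hc : (f.natDegree : K) * (f.leadingCoeff * g.leadingCoeff) =
        g.natDegree * (f.leadingCoeff * g.leadingCoeff) := by
      by_cases h0 : f.natDegree + g.natDegree = 0
      · have hf1 : f.natDegree = 0 := by omega
        have hg1 : g.natDegree = 0 := by omega
        rw [hf1, hg1]
      have hco : (Polynomial.X * f.derivative * g).coeff (f.natDegree + g.natDegree) =
          (f * (Polynomial.X * g.derivative)).coeff (f.natDegree + g.natDegree) := by
        congr 1
        linear_combination Polynomial.X * h
      have hd : ∀ p : Polynomial K, (Polynomial.X * p.derivative).natDegree ≤ p.natDegree := by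
        intro p
        by_cases hp : p.derivative = 0
        · simp [hp]
        rw [Polynomial.natDegree_X_mul hp]
        have : p.natDegree ≠ 0 := fun hp0 => hp (Polynomial.derivative_of_natDegree_zero hp0)
        have := Polynomial.natDegree_derivative_lt this
        omega
      have hl : ∀ p : Polynomial K, (Polynomial.X * p.derivative).coeff p.natDegree =
          p.natDegree * p.leadingCoeff := by
        intro p
        rcases hp : p.natDegree with _ | m
        · simp
        · rw [Polynomial.coeff_X_mul, Polynomial.coeff_derivative, Polynomial.leadingCoeff, hp]
          push_cast
          ring
      rw [Polynomial.coeff_mul_add_eq_of_natDegree_le (hd f) le_rfl,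
        Polynomial.coeff_mul_add_eq_of_natDegree_le le_rfl (hd g), hl, hl] at hco
      simp only [Polynomial.coeff_natDegree] at hco
      linear_combination hco
    have hlc : f.leadingCoeff * g.leadingCoeff ≠ 0 :=
      mul_ne_zero (Polynomial.leadingCoeff_ne_zero.2 hf0) (Polynomial.leadingCoeff_ne_zero.2 hg0)
    have hcast := mul_right_cancel₀ hlc hc
    by_contra hne
    rcases lt_or_gt_of_ne hne with hlt | hlt
    · refine hn (g.natDegree - f.natDegree) (by omega) (by omega) ?_
      rw [Nat.cast_sub hlt.le, hcast, sub_self]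
    · refine hn (f.natDegree - g.natDegree) (by omega) (by omega) ?_
      rw [Nat.cast_sub hlt.le, hcast, sub_self]
  by_cases hf0 : f = 0
  · exact ⟨0, by simp [hf0]⟩
  have hdeg := key f hf hf0 h
  refine ⟨f.leadingCoeff / g.leadingCoeff, ?_⟩
  have hg1 := Polynomial.leadingCoeff_ne_zero.2 hg0
  by_contra hne
  set r := f - Polynomial.C (f.leadingCoeff / g.leadingCoeff) * g with hr
  have hr0 : r ≠ 0 := sub_ne_zero.2 hne
  have hrn : r.natDegree ≤ g.natDegree :=
    (Polynomial.natDegree_sub_le_of_le hdeg.le (Polynomial.natDegree_C_mul_le _ _)).trans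
      (max_self _).le
  have hrd := key r (hrn.trans hg) hr0 (by
    rw [hr, Polynomial.derivative_sub, Polynomial.derivative_C_mul]
    linear_combination h)
  apply hr0
  rw [← Polynomial.leadingCoeff_eq_zero, Polynomial.leadingCoeff, hrd, hr, Polynomial.coeff_sub,
    Polynomial.coeff_C_mul, Polynomial.coeff_natDegree, div_mul_cancel₀ _ hg1, ← hdeg,
    Polynomial.coeff_natDegree, sub_self]

lemma Polynomial.exists_eq_linear_mul {n : ℕ}
    (hn : ∀ m : ℕ, 0 < m → m ≤ 2 * n + 1 → (m : K) ≠ 0) {A B : Polynomial K}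
    (hA : A.natDegree ≤ n) (hB : B.natDegree ≤ n) (hB0 : B ≠ 0)
    (h : B * (B * A.derivative.derivative - A * B.derivative.derivative) =
      2 * B.derivative * (B * A.derivative - A * B.derivative)) :
    ∃ c d : K, A = (Polynomial.C c * Polynomial.X + Polynomial.C d) * B := by
  have hd : ∀ p : Polynomial K, p.derivative.natDegree ≤ p.natDegree := fun p =>
    (Polynomial.natDegree_derivative_le p).trans (Nat.sub_le _ _)
  obtain ⟨c, hc⟩ := Polynomial.exists_eq_C_mul_of_wronskian_eq_zero
    (f := B * A.derivative - A * B.derivative) (g := B ^ 2) hn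
    ((Polynomial.natDegree_sub_le_of_le (Polynomial.natDegree_mul_le_of_le hB ((hd A).trans hA))
      (Polynomial.natDegree_mul_le_of_le hA ((hd B).trans hB))).trans (by rw [max_self]; omega))
    ((Polynomial.natDegree_pow_le_of_le 2 hB).trans (by omega)) (pow_ne_zero 2 hB0) (by
      simp only [Polynomial.derivative_sub, Polynomial.derivative_mul, Polynomial.derivative_pow]
      push_cast
      simp only [pow_one, Polynomial.C_ofNat]
      linear_combination B * h)
  obtain ⟨d, hd'⟩ := Polynomial.exists_eq_C_mul_of_wronskian_eq_zero
    (f := A - Polynomial.C c * Polynomial.X * B) (g := B) hn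
    ((Polynomial.natDegree_sub_le_of_le hA (Polynomial.natDegree_mul_le_of_le
      ((Polynomial.natDegree_C_mul_le c _).trans Polynomial.natDegree_X_le) hB)).trans
      (max_le (by omega) (by omega))) (by omega) hB0
    (by
      simp only [Polynomial.derivative_sub, Polynomial.derivative_mul, Polynomial.derivative_C,
        Polynomial.derivative_X]
      linear_combination hc)
  exact ⟨c, d, by linear_combination hd'⟩

end Flecnodal

/-- At most `k` members of `V` lie on a common non-vertical line. -/
def CollinearBound {K : Type*} [Field K] (V : Finset (K × K × K)) (k : ℕ) : Prop :=
  ∀ c d f a b g : K, c ≠ 0 ∨ d ≠ 0 →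
    (V.filter fun q => c * q.2.1 + d * q.1 = f ∧ q.2.2 = a * q.1 + b * q.2.1 + g).card ≤ k

section SurfaceBound

open MvPolynomial

variable {K : Type*} [Field K]

lemma CollinearBound.mono {V W : Finset (K × K × K)} {k : ℕ} (h : CollinearBound W k)
    (hVW : V ⊆ W) : CollinearBound V k := fun c d f a b g hcd =>
  (Finset.card_le_card (Finset.filter_subset_filter _ hVW)).trans (h c d f a b g hcd)

lemma totalDegree_turnDeriv_le (x : K) (P : MvPolynomial (Fin 3) K) :
    (turnDeriv x P).totalDegree ≤ P.totalDegree := by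
  have h1 : ∀ i, (pderiv i P).totalDegree ≤ P.totalDegree := fun i =>
    (totalDegree_pderiv_le i P).trans (Nat.sub_le _ _)
  have hc : (2 * C x : MvPolynomial (Fin 3) K).totalDegree ≤ 0 := by
    rw [← map_ofNat (C : K →+* MvPolynomial (Fin 3) K), ← C_mul]
    exact (totalDegree_C _).le
  rw [turnDeriv_apply]
  refine (totalDegree_add _ _).trans (max_le ?_ ?_)
  · rw [totalDegree_neg]
    exact h1 1
  · exact (totalDegree_mul _ _).trans (by linarith [h1 2])

/-- A line in a surface of degree `e` that meets many other lines of a triangle-free family in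
the surface is singular, if the surface is flecnodal in the sense of `remOne` and `remZero`. -/
lemma restrictLine_pderiv_eq_zero {V : Finset (K × K × K)} (hV : TriangleFree V) {k e : ℕ}
    (hk : CollinearBound V k) {P : MvPolynomial (Fin 3) K} (he : P.totalDegree ≤ e)
    (hchar : ∀ m : ℕ, 0 < m → m ≤ 2 * e + 1 → (m : K) ≠ 0)
    (hP : ∀ q ∈ V, restrictLine q P = 0) (h1 : P ∣ remOne P) (h0 : P ∣ remZero P)
    {q : K × K × K} (hq : q ∈ V) (hdeg : k + 1 + e ≤ (meetNbrs V q).card) (i : Fin 3) :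
    restrictLine q (pderiv i P) = 0 := by
  have hdA : (pderiv 2 P).totalDegree ≤ e :=
    (totalDegree_pderiv_le 2 P).trans ((Nat.sub_le _ _).trans he)
  have hdB : (turnDeriv q.1 P).totalDegree ≤ e := (totalDegree_turnDeriv_le _ P).trans he
  have hmem : ∀ q' ∈ meetNbrs V q, q' ∈ V ∧ LinesMeet q q' := fun q' hq' =>
    Finset.mem_filter.1 hq'
  have hmeet : ∀ q' ∈ meetNbrs V q, -(restrictLine q (turnDeriv q.1 P)).eval (meetParam q q') =
      (q'.1 - q.1) * (restrictLine q (pderiv 2 P)).eval (meetParam q q') := fun q' hq' =>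
    (hmem q' hq').2.eval_turnDeriv (hP q hq) (hP q' (hmem q' hq').1)
  have hsing : restrictLine q (pderiv 2 P) = 0 → restrictLine q (turnDeriv q.1 P) = 0 →
      restrictLine q (pderiv i P) = 0 := by
    intro hA hB
    have hE := restrictLine_slopeDeriv_eq_zero (hP q hq)
    have hPv : restrictLine q (pderiv 1 P) = 0 := by
      rw [turnDeriv_apply, map_add, map_mul, hA, mul_zero, add_zero, map_neg, neg_eq_zero] at hB
      exact hB
    have hPu : restrictLine q (pderiv 0 P) = 0 := by
      rw [slopeDeriv_apply, map_add, map_mul, hA, mul_zero, add_zero, map_sub, map_mul, hPv,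
        mul_zero, sub_zero] at hE
      exact hE
    fin_cases i
    exacts [hPu, hPv, hA]
  by_cases hA : restrictLine q (pderiv 2 P) = 0
  · refine hsing hA ?_
    by_contra hB
    have := hV.card_meetNbrs_le hq hB subset_rfl (fun q' hq' => by
      have := hmeet q' hq'
      rwa [hA, Polynomial.eval_zero, mul_zero, neg_eq_zero] at this)
    omega
  by_cases hB : restrictLine q (turnDeriv q.1 P) = 0
  · have := hV.card_meetNbrs_le hq hA subset_rfl (fun q' hq' => by
      have h := hmeet q' hq'
      rw [hB, Polynomial.eval_zero, neg_zero, eq_comm] at h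
      exact (mul_eq_zero.1 h).resolve_left (sub_ne_zero.2 (hmem q' hq').2.1.symm))
    omega
  exfalso
  have hB' : -restrictLine q (turnDeriv q.1 P) ≠ 0 := neg_ne_zero.2 hB
  have hW := wronskian_eq_of_dvd_rem (hP q hq) h1 h0 rfl rfl
  have hW := sub_eq_zero.1
    ((mul_eq_zero.1 hW).resolve_left (mul_ne_zero (pow_ne_zero 3 hA) hB'))
  obtain ⟨c, d, hcd⟩ := Polynomial.exists_eq_linear_mul hchar
    ((natDegree_restrictLine_le q _).trans hdA)
    ((Polynomial.natDegree_neg _).trans_le ((natDegree_restrictLine_le q _).trans hdB)) hB' hW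
  have hcd0 : c ≠ 0 ∨ d ≠ 0 := by
    by_contra! h
    rw [h.1, h.2] at hcd
    simp at hcd
    exact hA hcd
  have hbad : ((meetNbrs V q).filter fun q' =>
      (restrictLine q (turnDeriv q.1 P)).eval (meetParam q q') = 0).card ≤ e :=
    (hV.card_meetNbrs_le hq hB (Finset.filter_subset _ _) fun q' hq' =>
      (Finset.mem_filter.1 hq').2).trans hdB
  have hgood : ((meetNbrs V q).filter fun q' =>
      ¬ (restrictLine q (turnDeriv q.1 P)).eval (meetParam q q') = 0).card ≤ k := by
    refine (Finset.card_le_card fun q' hq' => ?_).trans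
      (hk c d (1 + c * q.2.1 + d * q.1) q.2.1 (-q.1) q.2.2 hcd0)
    obtain ⟨hq', hne⟩ := Finset.mem_filter.1 hq'
    refine Finset.mem_filter.2 ⟨(hmem q' hq').1, ?_, ?_⟩
    · have e1 := hmeet q' hq'
      have e2 := congrArg (Polynomial.eval (meetParam q q')) hcd
      have e3 := (hmem q' hq').2.snd_sub
      simp only [Polynomial.eval_mul, Polynomial.eval_add, Polynomial.eval_C, Polynomial.eval_X,
        Polynomial.eval_neg] at e2
      rw [e2] at e1
      have e4 : (q'.1 - q.1) * (c * meetParam q q' + d) = 1 := by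
        apply mul_right_cancel₀ (neg_ne_zero.2 hne)
        linear_combination -e1
      linear_combination e4 - c * e3
    · linear_combination (hmem q' hq').2.2
  have := Finset.card_filter_add_card_filter_not (s := meetNbrs V q)
    (fun q' => (restrictLine q (turnDeriv q.1 P)).eval (meetParam q q') = 0)
  omega

lemma MvPolynomial.totalDegree_le_of_dvd_of_ne_zero {σ R : Type*} [CommRing R] [IsDomain R]
    {P Q : MvPolynomial σ R} (h : P ∣ Q) (hQ : Q ≠ 0) : P.totalDegree ≤ Q.totalDegree := by
  obtain ⟨S, rfl⟩ := h
  rw [totalDegree_mul_of_isDomain (left_ne_zero_of_mul hQ) (right_ne_zero_of_mul hQ)]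
  exact Nat.le_add_right _ _

lemma MvPolynomial.exists_pderiv_ne_zero {σ R : Type*} [CommRing R] [IsDomain R]
    {P : MvPolynomial σ R} (hP : P.totalDegree ≠ 0)
    (hchar : ∀ m : ℕ, 0 < m → m ≤ P.totalDegree → (m : R) ≠ 0) : ∃ i, pderiv i P ≠ 0 := by
  have : ∃ m ∈ P.support, m ≠ 0 := by
    by_contra! h
    apply hP
    rw [← Nat.le_zero]
    exact Finset.sup_le fun m hm => by simp [h m hm]
  obtain ⟨m, hm, hm0⟩ := this
  obtain ⟨i, hi⟩ := Finsupp.ne_iff.1 hm0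
  refine ⟨i, fun h => ?_⟩
  have hc := congrArg (coeff (m - Finsupp.single i 1)) h
  have hmi : m i ≤ P.totalDegree := (Finsupp.le_degree i m).trans (le_totalDegree hm)
  have hpos : 0 < m i := Nat.pos_of_ne_zero hi
  rw [coeff_pderiv, tsub_add_cancel_of_le (Finsupp.single_le_iff.2 hpos), coeff_zero] at hc
  rcases mul_eq_zero.1 hc with hc | hc
  · exact (mem_support_iff.1 hm) hc
  · apply hchar (m i) hpos hmi
    have : m i - 1 + 1 = m i := by omega
    rw [← this]
    push_cast
    simpa using hc

lemma MvPolynomial.totalDegree_ne_zero_of_irreducible {σ : Type*} {P : MvPolynomial σ K}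
    (hP : Irreducible P) : P.totalDegree ≠ 0 := by
  intro h
  have hC := totalDegree_eq_zero_iff_eq_C.1 h
  apply hP.not_isUnit
  rw [hC]
  refine (IsUnit.mk0 (coeff 0 P) fun h0 => hP.ne_zero ?_).map C
  rw [hC, h0, C_0]

lemma card_le_of_irreducible {V : Finset (K × K × K)} (hV : TriangleFree V) {k : ℕ}
    (hk : CollinearBound V k) {P : MvPolynomial (Fin 3) K} (hirr : Irreducible P)
    (hchar : ∀ m : ℕ, 0 < m → m ≤ 2 * P.totalDegree + 1 → (m : K) ≠ 0)
    (hP : ∀ q ∈ V, restrictLine q P = 0)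
    (hdeg : ∀ q ∈ V, k + 1 + 5 * P.totalDegree ≤ (meetNbrs V q).card) :
    V.card ≤ 8 * P.totalDegree ^ 2 := by
  set e := P.totalDegree with he
  have hrem : ∀ R : MvPolynomial (Fin 3) K, R.totalDegree ≤ 4 * e →
      (∀ q ∈ V, ∀ q' ∈ V, LinesMeet q q' → (restrictLine q R).eval (meetParam q q') = 0) →
      ¬ P ∣ R → V.card ≤ 8 * e ^ 2 := by
    intro R hRe hR hdvd
    have hRV : ∀ q ∈ V, restrictLine q R = 0 := by
      intro q hq
      by_contra hne
      have := hV.card_meetNbrs_le hq hne subset_rfl fun q' hq' =>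
        hR q hq q' (Finset.mem_filter.1 hq').1 (Finset.mem_filter.1 hq').2
      have := hdeg q hq
      omega
    calc V.card ≤ 2 * e * R.totalDegree := card_le_of_restrictLine_eq_zero hirr hdvd V hP hRV
      _ ≤ 2 * e * (4 * e) := Nat.mul_le_mul_left _ hRe
      _ = 8 * e ^ 2 := by ring
  by_cases h1 : P ∣ remOne P
  swap
  · exact hrem _ (totalDegree_remOne_le P)
      (fun q hq q' hq' h => (h.eval_rem_eq_zero (hP q hq) (hP q' hq')).1) h1
  by_cases h0 : P ∣ remZero P
  swap
  · exact hrem _ (totalDegree_remZero_le P)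
      (fun q hq q' hq' h => (h.eval_rem_eq_zero (hP q hq) (hP q' hq')).2) h0
  have hpos : e ≠ 0 := totalDegree_ne_zero_of_irreducible hirr
  obtain ⟨i, hi⟩ := exists_pderiv_ne_zero hpos fun m hm hme => hchar m hm (by omega)
  have hlt : (pderiv i P).totalDegree < e :=
    (totalDegree_pderiv_le i P).trans_lt (by omega)
  have hdvd : ¬ P ∣ pderiv i P := fun h =>
    absurd (totalDegree_le_of_dvd_of_ne_zero h hi) (by omega)
  refine hrem _ (by omega) (fun q hq q' _ _ => ?_) hdvd
  rw [restrictLine_pderiv_eq_zero hV hk le_rfl hchar hP h1 h0 hq (by have := hdeg q hq; omega) i,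
    Polynomial.eval_zero]

/-- A triangle-free family of lines on a surface of degree `e`, each meeting many others and
without many collinear parameters, has `O(e ^ 2)` members. -/
theorem card_le_of_forall_restrictLine_eq_zero {k : ℕ} {V : Finset (K × K × K)}
    (hV : TriangleFree V) (hk : CollinearBound V k) {P : MvPolynomial (Fin 3) K} (hP0 : P ≠ 0)
    (hchar : ∀ m : ℕ, 0 < m → m ≤ 2 * P.totalDegree + 1 → (m : K) ≠ 0)
    (hP : ∀ q ∈ V, restrictLine q P = 0)
    (hdeg : ∀ q ∈ V, k + 1 + 5 * P.totalDegree ≤ (meetNbrs V q).card) :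
    V.card ≤ 8 * P.totalDegree ^ 2 := by
  induction hn : P.totalDegree using Nat.strong_induction_on generalizing P V with
  | _ n ih =>
  subst hn
  by_cases hu : IsUnit P
  · have : V = ∅ := by
      rw [Finset.eq_empty_iff_forall_notMem]
      intro q hq
      have := hu.map (restrictLine q)
      rw [hP q hq] at this
      exact not_isUnit_zero this
    simp [this]
  obtain ⟨R, hR, S, rfl⟩ := WfDvdMonoid.exists_irreducible_factor hu hP0
  have hR0 := hR.ne_zero
  have hS0 := right_ne_zero_of_mul hP0
  have hRpos : R.totalDegree ≠ 0 := totalDegree_ne_zero_of_irreducible hR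
  rw [totalDegree_mul_of_isDomain hR0 hS0] at ih hchar hdeg ⊢
  set r := R.totalDegree with hr
  set s := S.totalDegree with hs
  have hRS : ∀ q ∈ V, restrictLine q R = 0 ∨ restrictLine q S = 0 := by
    intro q hq
    have := hP q hq
    rwa [map_mul, mul_eq_zero] at this
  by_cases hdvd : R ∣ S
  · refine (ih s (by omega) hV hk hS0 (fun m hm hm' => hchar m hm (by omega)) (fun q hq => ?_)
      (fun q hq => by have := hdeg q hq; omega) rfl).trans (by gcongr; omega)
    rcases hRS q hq with h | h
    · obtain ⟨T, rfl⟩ := hdvd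
      rw [map_mul, h, zero_mul]
    · exact h
  have hlose : ∀ (T : MvPolynomial (Fin 3) K) (q : K × K × K), q ∈ V → restrictLine q T ≠ 0 →
      (meetNbrs V q).card ≤ (meetNbrs (V.filter fun q => restrictLine q T ≠ 0) q).card +
        T.totalDegree := by
    intro T q hq hT
    have h1 := hV.card_meetNbrs_le (W := (meetNbrs V q).filter fun q' => restrictLine q' T = 0)
      hq hT (Finset.filter_subset _ _) (fun q' hq' => by
        obtain ⟨h1, h2⟩ := Finset.mem_filter.1 hq'
        rw [(Finset.mem_filter.1 h1).2.eval_eq, h2, Polynomial.eval_zero])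
    have h2 := Finset.card_filter_add_card_filter_not (s := meetNbrs V q)
      (fun q' => restrictLine q' T = 0)
    have h3 : ((meetNbrs V q).filter fun q' => ¬ restrictLine q' T = 0) =
        meetNbrs (V.filter fun q => restrictLine q T ≠ 0) q := by
      rw [meetNbrs, meetNbrs, Finset.filter_comm]
    rw [h3] at h2
    omega
  have b1 : (V.filter fun q => restrictLine q R ≠ 0).card ≤ 8 * s ^ 2 := by
    refine ih s (by omega) (hV.mono (Finset.filter_subset _ _)) (hk.mono (Finset.filter_subset _ _))
      hS0 (fun m hm hm' => hchar m hm (by omega)) (fun q hq => ?_) (fun q hq => ?_) rfl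
    · obtain ⟨hqV, hqR⟩ := Finset.mem_filter.1 hq
      exact (hRS q hqV).resolve_left hqR
    · obtain ⟨hqV, hqR⟩ := Finset.mem_filter.1 hq
      have := hlose R q hqV hqR
      have := hdeg q hqV
      omega
  have b2 : (V.filter fun q => restrictLine q S ≠ 0).card ≤ 8 * r ^ 2 := by
    refine card_le_of_irreducible (hV.mono (Finset.filter_subset _ _))
      (hk.mono (Finset.filter_subset _ _)) hR (fun m hm hm' => hchar m hm (by omega))
      (fun q hq => ?_) (fun q hq => ?_)
    · obtain ⟨hqV, hqS⟩ := Finset.mem_filter.1 hq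
      exact (hRS q hqV).resolve_right hqS
    · obtain ⟨hqV, hqS⟩ := Finset.mem_filter.1 hq
      have := hlose S q hqV hqS
      have := hdeg q hqV
      omega
  have b3 : (V.filter fun q => restrictLine q R = 0 ∧ restrictLine q S = 0).card ≤ 2 * r * s :=
    card_le_of_restrictLine_eq_zero hR hdvd _ (fun q hq => (Finset.mem_filter.1 hq).2.1)
      (fun q hq => (Finset.mem_filter.1 hq).2.2)
  have hcover : V ⊆ (V.filter fun q => restrictLine q R ≠ 0) ∪
      ((V.filter fun q => restrictLine q S ≠ 0) ∪
        V.filter fun q => restrictLine q R = 0 ∧ restrictLine q S = 0) := by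
    intro q hq
    simp only [Finset.mem_union, Finset.mem_filter, hq, true_and]
    tauto
  have := (Finset.card_le_card hcover).trans ((Finset.card_union_le _ _).trans
    (Nat.add_le_add_left (Finset.card_union_le _ _) _))
  nlinarith [Nat.zero_le (r * s)]

end SurfaceBound

section MeetingPairs

variable {K : Type*} [Field K]

lemma meetNbrs_erase (Q : Finset (K × K × K)) (q₀ q : K × K × K) :
    meetNbrs (Q.erase q₀) q = (meetNbrs Q q).erase q₀ := by
  rw [meetNbrs, meetNbrs, Finset.filter_erase]

/-- Removing members that meet few others leads to a family of large minimal degree. -/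
lemma sum_card_meetNbrs_le_or_exists_subset (D : ℝ) (Q : Finset (K × K × K)) :
    ∑ q ∈ Q, ((meetNbrs Q q).card : ℝ) ≤ 2 * D * Q.card ∨
      ∃ V ⊆ Q, V.Nonempty ∧ ∀ q ∈ V, D ≤ (meetNbrs V q).card := by
  induction Q using Finset.strongInduction with
  | H Q ih =>
  rcases Q.eq_empty_or_nonempty with rfl | hQ
  · simp
  by_cases h : ∀ q ∈ Q, D ≤ (meetNbrs Q q).card
  · exact Or.inr ⟨Q, subset_rfl, hQ, h⟩
  push Not at h
  obtain ⟨q₀, hq₀, hlt⟩ := h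
  rcases ih (Q.erase q₀) (Finset.erase_ssubset hq₀) with hi | ⟨V, hV, hV'⟩
  swap
  · exact Or.inr ⟨V, hV.trans (Finset.erase_subset _ _), hV'⟩
  left
  have hirr : ¬ LinesMeet q₀ q₀ := fun h => h.1 rfl
  have hterm : ∀ q ∈ Q.erase q₀, ((meetNbrs Q q).card : ℝ) =
      (meetNbrs (Q.erase q₀) q).card + if LinesMeet q₀ q then 1 else 0 := by
    intro q _
    rw [meetNbrs_erase]
    split_ifs with hm
    · have hmem : q₀ ∈ meetNbrs Q q := Finset.mem_filter.2 ⟨hq₀, hm.symm⟩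
      rw [Finset.card_erase_of_mem hmem, Nat.cast_sub (Finset.card_pos.2 ⟨_, hmem⟩)]
      simp
    · rw [Finset.erase_eq_of_notMem, add_zero]
      intro hmem
      exact hm (Finset.mem_filter.1 hmem).2.symm
  have hcount : ∑ q ∈ Q.erase q₀, (if LinesMeet q₀ q then (1 : ℝ) else 0) =
      (meetNbrs Q q₀).card := by
    rw [Finset.sum_boole, ← meetNbrs, meetNbrs_erase, Finset.erase_eq_of_notMem]
    exact fun hmem => hirr (Finset.mem_filter.1 hmem).2
  rw [← Finset.add_sum_erase _ _ hq₀, Finset.sum_congr rfl hterm, Finset.sum_add_distrib, hcount]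
  rw [Finset.card_erase_of_mem hq₀, Nat.cast_sub (Finset.card_pos.2 hQ)] at hi
  push_cast at hi
  linarith

/-- An upper bound for the number of intersecting pairs in a triangle-free family of lines. -/
theorem sum_card_meetNbrs_le [Infinite K] {Q : Finset (K × K × K)} (hQ : TriangleFree Q) {k : ℕ}
    (hk : CollinearBound Q k)
    (hchar : ∀ m : ℕ, 0 < m → (m : ℝ) ≤ 2 * √(Q.card : ℝ) → (m : K) ≠ 0) :
    ∑ q ∈ Q, ((meetNbrs Q q).card : ℝ) ≤ 2 * (k + 3000000 * √(Q.card : ℝ)) * Q.card := by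
  rcases sum_card_meetNbrs_le_or_exists_subset (k + 3000000 * √(Q.card : ℝ)) Q with
    h | ⟨V, hVQ, ⟨q₀, hq₀⟩, hV⟩
  · exact h
  exfalso
  have hcard : (V.card : ℝ) ≤ Q.card := by exact_mod_cast Finset.card_le_card hVQ
  set x := √(V.card : ℝ) with hx
  have hx2 : x ^ 2 = V.card := Real.sq_sqrt (Nat.cast_nonneg _)
  have hxy : x ≤ √(Q.card : ℝ) := Real.sqrt_le_sqrt hcard
  have hV1 : (1 : ℝ) ≤ V.card := by exact_mod_cast Finset.card_pos.2 ⟨q₀, hq₀⟩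
  have hx1 : 1 ≤ x := Real.one_le_sqrt.2 hV1
  have hk0 : (0 : ℝ) ≤ k := Nat.cast_nonneg k
  have hbig : 3000000 * x ≤ x ^ 2 := by
    have h1 : ((meetNbrs V q₀).card : ℝ) ≤ V.card := by
      exact_mod_cast Finset.card_le_card (Finset.filter_subset _ _)
    linarith [hV q₀ hq₀]
  have hxbig : 3000000 ≤ x := by nlinarith
  set j := ⌊x / 9⌋₊ with hj
  have hj1 : (j : ℝ) ≤ x / 9 := Nat.floor_le (by positivity)
  have hj2 : x / 9 < j + 1 := Nat.lt_floor_add_one _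
  obtain ⟨P, hP0, hPd, hPV⟩ := exists_ne_zero_restrictLine_eq_zero (hQ.mono hVQ) hV j
    (by linarith)
    (by
      calc 72 * (V.card : ℝ) = x / 9 * (648 * x) := by rw [← hx2]; ring
        _ ≤ (j + 1) * (k + 3000000 * √(Q.card : ℝ)) := by
          apply mul_le_mul hj2.le <;> nlinarith)
    (by
      calc 2 * (V.card : ℝ) < (x / 9) ^ 3 := by rw [← hx2]; nlinarith [sq_nonneg x]
        _ ≤ (j + 1) ^ 3 := by gcongr)
  have hle := card_le_of_forall_restrictLine_eq_zero (hQ.mono hVQ) (hk.mono hVQ) hP0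
    (fun m hm hm' => hchar m hm (by
      have : (m : ℝ) ≤ 2 * (3 * j) + 1 := by exact_mod_cast hm'.trans (by omega)
      linarith)) hPV
    (fun q hq => by
      have h1 := hV q hq
      have h2 : ((k + 1 + 5 * (3 * j) : ℕ) : ℝ) ≤ (meetNbrs V q).card := by
        push_cast
        linarith
      have h3 : k + 1 + 5 * (3 * j) ≤ (meetNbrs V q).card := by exact_mod_cast h2
      omega)
  have h4 : V.card ≤ 8 * (3 * j) ^ 2 := hle.trans (by gcongr)
  have h5 : (V.card : ℝ) ≤ 8 * (3 * j) ^ 2 := by exact_mod_cast h4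
  have h6 : (j : ℝ) ^ 2 ≤ (x / 9) ^ 2 := by gcongr
  nlinarith

end MeetingPairs

section PointLineEnergy

variable {K : Type*} [Field K]

/-- The first of two embeddings of pairs of a number and a (non-vertical) line in the plane. -/
def leftParam (s t : K) (p : K × K × K) : K × K × K :=
  (p.1 + s, t * p.2.1, p.2.2 - p.2.1 * s)

/-- The second of two embeddings of pairs of a number and a (non-vertical) line in the plane. -/
def rightParam (s t : K) (p : K × K × K) : K × K × K :=
  ((p.1 + s) / t, p.2.1, p.2.2 - p.2.1 * s)

lemma leftParam_injective (s : K) {t : K} (ht : t ≠ 0) : Function.Injective (leftParam s t) := by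
  rintro ⟨x, m, k⟩ ⟨x', m', k'⟩ h
  simp only [leftParam, Prod.mk.injEq] at h
  obtain ⟨h1, h2, h3⟩ := h
  have hx := add_right_cancel h1
  have hm := mul_left_cancel₀ ht h2
  subst hx hm
  have hk := sub_left_injective h3
  subst hk
  rfl

lemma rightParam_injective (s : K) {t : K} (ht : t ≠ 0) :
    Function.Injective (rightParam s t) := by
  rintro ⟨x, m, k⟩ ⟨x', m', k'⟩ h
  simp only [rightParam, Prod.mk.injEq] at h
  obtain ⟨h1, h2, h3⟩ := h
  have hx := add_right_cancel ((div_left_inj' ht).1 h1)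
  subst hx h2
  have hk := sub_left_injective h3
  subst hk
  rfl

lemma exists_shift [Infinite K] (X : Finset K) (L : Finset (K × K)) (hL : ∀ l ∈ L, l.1 ≠ 0) :
    ∃ s : K, (∀ x ∈ X, x + s ≠ 0) ∧ ∀ x ∈ X, ∀ x' ∈ X, x ≠ x' → ∀ l ∈ L, ∀ l' ∈ L,
      (x + s) * l'.1 - (x' + s) * l.1 ≠ 0 := by
  obtain ⟨s, hs⟩ := Infinite.exists_notMem_finset (X.image (fun x => -x) ∪
    ((X ×ˢ X) ×ˢ (L ×ˢ L)).image
      fun p => -(p.1.1 * p.2.2.1 - p.1.2 * p.2.1.1) / (p.2.2.1 - p.2.1.1))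
  rw [Finset.notMem_union] at hs
  refine ⟨s, fun x hx h => hs.1 (Finset.mem_image.2 ⟨x, hx, by linear_combination -h⟩),
    fun x hx x' hx' hne l hl l' hl' h => ?_⟩
  by_cases hm : l.1 = l'.1
  · rw [hm] at h
    have : (x - x') * l'.1 = 0 := by linear_combination h
    rcases mul_eq_zero.1 this with h | h
    exacts [hne (sub_eq_zero.1 h), hL l' hl' h]
  · refine hs.2 (Finset.mem_image.2 ⟨((x, x'), (l, l')), by simp [hx, hx', hl, hl'], ?_⟩)
    have : l'.1 - l.1 ≠ 0 := sub_ne_zero.2 (Ne.symm hm)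
    rw [div_eq_iff this]
    linear_combination -h

lemma exists_scale [Infinite K] (X : Finset K) (L : Finset (K × K)) (hL : ∀ l ∈ L, l.1 ≠ 0) :
    ∃ s t : K, t ≠ 0 ∧
      (∀ p ∈ X ×ˢ L, ∀ p' ∈ X ×ˢ L, ¬ LinesMeet (leftParam s t p) (leftParam s t p')) ∧
      (∀ p ∈ X ×ˢ L, ∀ p' ∈ X ×ˢ L, ¬ LinesMeet (rightParam s t p) (rightParam s t p')) ∧
      ∀ p ∈ X ×ˢ L, ∀ p' ∈ X ×ˢ L, (leftParam s t p).1 ≠ (rightParam s t p').1 := by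
  obtain ⟨s, hs, hu⟩ := exists_shift X L hL
  let u : (K × K × K) × (K × K × K) → K := fun r =>
    (r.1.1 + s) * r.2.2.1 - (r.2.1 + s) * r.1.2.1
  let w : (K × K × K) × (K × K × K) → K := fun r =>
    r.2.2.2 - r.1.2.2 - s * (r.2.2.1 - r.1.2.1)
  obtain ⟨t, ht⟩ := Infinite.exists_notMem_finset ({0} ∪
    (((X ×ˢ L) ×ˢ (X ×ˢ L)).image (fun r => -w r / u r) ∪
      (((X ×ˢ L) ×ˢ (X ×ˢ L)).image (fun r => -u r / w r) ∪
        ((X ×ˢ L) ×ˢ (X ×ˢ L)).image fun r => (r.2.1 + s) / (r.1.1 + s))))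
  simp only [Finset.notMem_union, Finset.mem_singleton] at ht
  obtain ⟨ht0, ht1, ht2, ht3⟩ := ht
  refine ⟨s, t, ht0, fun p hp p' hp' h => ?_, fun p hp p' hp' h => ?_, fun p hp p' hp' h => ?_⟩
  · have hx : p.1 ≠ p'.1 := fun hx => h.1 (by simp [leftParam, hx])
    have hp1 := Finset.mem_product.1 hp
    have hp2 := Finset.mem_product.1 hp'
    have hu0 : u (p, p') ≠ 0 := hu _ hp1.1 _ hp2.1 hx _ hp1.2 _ hp2.2
    refine ht1 (Finset.mem_image.2 ⟨(p, p'), Finset.mk_mem_product hp hp', ?_⟩)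
    rw [div_eq_iff hu0]
    have := h.2
    simp only [leftParam] at this
    simp only [u, w]
    linear_combination -this
  · have hx : p.1 ≠ p'.1 := fun hx => h.1 (by simp [rightParam, hx])
    have hp1 := Finset.mem_product.1 hp
    have hp2 := Finset.mem_product.1 hp'
    have hu0 : u (p, p') ≠ 0 := hu _ hp1.1 _ hp2.1 hx _ hp1.2 _ hp2.2
    have huw : u (p, p') + t * w (p, p') = 0 := by
      have := h.2
      simp only [rightParam] at this
      field_simp at this
      simp only [u, w]
      linear_combination this
    have hw0 : w (p, p') ≠ 0 := by
      intro hw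
      rw [hw, mul_zero, add_zero] at huw
      exact hu0 huw
    refine ht2 (Finset.mem_image.2 ⟨(p, p'), Finset.mk_mem_product hp hp', ?_⟩)
    rw [div_eq_iff hw0]
    linear_combination -huw
  · refine ht3 (Finset.mem_image.2 ⟨(p, p'), Finset.mk_mem_product hp hp', ?_⟩)
    have h0 := hs _ (Finset.mem_product.1 hp).1
    simp only [leftParam, rightParam] at h
    rw [eq_div_iff ht0] at h
    rw [div_eq_iff h0]
    linear_combination -h

lemma collinearBound_image {X : Finset K} {L : Finset (K × K)} {κ : ℕ}
    (hκ : ∀ u v : K, (L.filter fun l => l.1 * u + l.2 = v).card ≤ κ) {f : K × K × K → K × K × K}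
    {s t₁ t₂ : K} (ht₁ : t₁ ≠ 0) (ht₂ : t₂ ≠ 0)
    (hf : ∀ p, f p = ((p.1 + s) * t₁, t₂ * p.2.1, p.2.2 - p.2.1 * s)) :
    CollinearBound ((X ×ˢ L).image f) (X.card + κ) := by
  intro c d e a b g hcd
  rw [Finset.filter_image]
  refine Finset.card_image_le.trans ?_
  by_cases hc : c = 0
  · have hd := hcd.resolve_left (not_not.2 hc)
    refine le_trans ?_ ((hκ (-(s + b * t₂)) (a * (e / d) + g)).trans (Nat.le_add_left _ _))
    apply Finset.card_le_card_of_injOn Prod.snd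
    · intro p hp
      obtain ⟨hp, h1, h2⟩ := Finset.mem_filter.1 hp
      rw [hf] at h1 h2
      simp only at h1 h2
      have h3 : (p.1 + s) * t₁ = e / d := by
        rw [eq_div_iff hd]
        rw [hc] at h1
        linear_combination h1
      rw [h3] at h2
      exact Finset.mem_filter.2 ⟨(Finset.mem_product.1 hp).2, by linear_combination h2⟩
    · intro p hp p' hp' h
      have h1 := (Finset.mem_filter.1 hp).2.1
      have h1' := (Finset.mem_filter.1 hp').2.1
      rw [hf] at h1 h1'
      simp only [hc, zero_mul, zero_add] at h1 h1'
      have := mul_right_cancel₀ ht₁ (mul_left_cancel₀ hd (h1.trans h1'.symm))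
      exact Prod.ext (add_right_cancel this) h
  · refine le_trans ?_ (Nat.le_add_right _ _)
    apply Finset.card_le_card_of_injOn Prod.fst
    · intro p hp
      exact (Finset.mem_product.1 (Finset.mem_filter.1 hp).1).1
    · intro p hp p' hp' h
      obtain ⟨-, h1, h2⟩ := Finset.mem_filter.1 hp
      obtain ⟨-, h1', h2'⟩ := Finset.mem_filter.1 hp'
      rw [hf] at h1 h2 h1' h2'
      simp only at h1 h2 h1' h2' h
      rw [h] at h1 h2
      have hm : p.2.1 = p'.2.1 := by
        apply mul_left_cancel₀ (mul_ne_zero hc ht₂)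
        linear_combination h1 - h1'
      rw [hm] at h2
      exact Prod.ext h (Prod.ext hm (by linear_combination h2 - h2'))

lemma CollinearBound.union {V W : Finset (K × K × K)} {k l : ℕ} (hV : CollinearBound V k)
    (hW : CollinearBound W l) : CollinearBound (V ∪ W) (k + l) := by
  intro c d f a b g hcd
  rw [Finset.filter_union]
  exact (Finset.card_union_le _ _).trans
    (add_le_add (hV c d f a b g hcd) (hW c d f a b g hcd))

/-- A bound for the energy of the values of a family of affine functions on a finite set. -/
theorem card_eval_eq_le [Infinite K] (X : Finset K) (L : Finset (K × K))
    (hL : ∀ l ∈ L, l.1 ≠ 0) {κ : ℕ}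
    (hκ : ∀ u v : K, (L.filter fun l => l.1 * u + l.2 = v).card ≤ κ)
    (hchar : ∀ m : ℕ, 0 < m → (m : ℝ) ≤ 2 * √(2 * (X.card * L.card) : ℝ) → (m : K) ≠ 0) :
    ((((X ×ˢ L) ×ˢ (X ×ˢ L)).filter fun r =>
      r.2.2.1 * r.1.1 + r.2.2.2 = r.1.2.1 * r.2.1 + r.1.2.2).card : ℝ) ≤
      4 * (X.card * L.card) *
        (2 * (X.card + κ) + 3000000 * √(2 * (X.card * L.card) : ℝ)) := by
  obtain ⟨s, t, ht, hl, hr, hlr⟩ := exists_scale X L hL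
  set Q₁ := (X ×ˢ L).image (leftParam s t) with hQ₁
  set Q₂ := (X ×ˢ L).image (rightParam s t) with hQ₂
  set Q := Q₁ ∪ Q₂ with hQ
  have hQ₁' : ∀ q ∈ Q₁, ∀ q' ∈ Q₁, ¬ LinesMeet q q' := by
    intro q hq q' hq'
    obtain ⟨p, hp, rfl⟩ := Finset.mem_image.1 hq
    obtain ⟨p', hp', rfl⟩ := Finset.mem_image.1 hq'
    exact hl p hp p' hp'
  have hQ₂' : ∀ q ∈ Q₂, ∀ q' ∈ Q₂, ¬ LinesMeet q q' := by
    intro q hq q' hq'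
    obtain ⟨p, hp, rfl⟩ := Finset.mem_image.1 hq
    obtain ⟨p', hp', rfl⟩ := Finset.mem_image.1 hq'
    exact hr p hp p' hp'
  have htri : TriangleFree Q := by
    intro q hq q' hq' q'' hq'' h h' h''
    rcases Finset.mem_union.1 hq with hq | hq <;> rcases Finset.mem_union.1 hq' with hq' | hq' <;>
      rcases Finset.mem_union.1 hq'' with hq'' | hq'' <;>
      first
      | exact hQ₁' _ hq _ hq' h
      | exact hQ₁' _ hq _ hq'' h'
      | exact hQ₁' _ hq' _ hq'' h''
      | exact hQ₂' _ hq _ hq' h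
      | exact hQ₂' _ hq _ hq'' h'
      | exact hQ₂' _ hq' _ hq'' h''
  have hcard : Q.card ≤ 2 * (X.card * L.card) := by
    rw [two_mul, ← Finset.card_product]
    exact (Finset.card_union_le _ _).trans (add_le_add Finset.card_image_le Finset.card_image_le)
  have hcard' : (Q.card : ℝ) ≤ 2 * (X.card * L.card) := by exact_mod_cast hcard
  have hcol : CollinearBound Q (X.card + κ + (X.card + κ)) :=
    (collinearBound_image (s := s) hκ one_ne_zero ht fun p => by simp [leftParam]).union
      (collinearBound_image (s := s) hκ (inv_ne_zero ht) one_ne_zero fun p => by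
        simp [rightParam, div_eq_mul_inv])
  have hmain := sum_card_meetNbrs_le htri hcol fun m hm hm' => hchar m hm (hm'.trans (by gcongr))
  have hcount : (((X ×ˢ L) ×ˢ (X ×ˢ L)).filter fun r =>
      r.2.2.1 * r.1.1 + r.2.2.2 = r.1.2.1 * r.2.1 + r.1.2.2).card ≤
      ∑ q ∈ Q, (meetNbrs Q q).card := by
    calc (((X ×ˢ L) ×ˢ (X ×ˢ L)).filter fun r =>
          r.2.2.1 * r.1.1 + r.2.2.2 = r.1.2.1 * r.2.1 + r.1.2.2).card
        = ∑ p ∈ X ×ˢ L, ((X ×ˢ L).filter fun p' =>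
            p'.2.1 * p.1 + p'.2.2 = p.2.1 * p'.1 + p.2.2).card := by
          simp_rw [Finset.card_filter]
          rw [Finset.sum_product]
      _ ≤ ∑ p ∈ X ×ˢ L, (meetNbrs Q (leftParam s t p)).card := by
          refine Finset.sum_le_sum fun p hp => ?_
          apply Finset.card_le_card_of_injOn (rightParam s t)
          · intro p' hp'
            obtain ⟨hp', h⟩ := Finset.mem_filter.1 hp'
            refine Finset.mem_filter.2 ⟨Finset.mem_union_right _ (Finset.mem_image_of_mem _ hp'),
              hlr p hp p' hp', ?_⟩
            simp only [leftParam, rightParam]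
            field_simp
            linear_combination h
          · exact (rightParam_injective s ht).injOn
      _ = ∑ q ∈ Q₁, (meetNbrs Q q).card := by
          rw [hQ₁, Finset.sum_image (leftParam_injective s ht).injOn]
      _ ≤ ∑ q ∈ Q, (meetNbrs Q q).card :=
          Finset.sum_le_sum_of_subset Finset.subset_union_left
  have hcount' : ((((X ×ˢ L) ×ˢ (X ×ˢ L)).filter fun r =>
      r.2.2.1 * r.1.1 + r.2.2.2 = r.1.2.1 * r.2.1 + r.1.2.2).card : ℝ) ≤
      ∑ q ∈ Q, ((meetNbrs Q q).card : ℝ) := by exact_mod_cast hcount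
  refine hcount'.trans (hmain.trans ?_)
  calc 2 * (((X.card + κ + (X.card + κ) : ℕ) : ℝ) + 3000000 * √(Q.card : ℝ)) * Q.card
      ≤ 2 * (((X.card + κ + (X.card + κ) : ℕ) : ℝ) +
          3000000 * √(2 * (X.card * L.card) : ℝ)) * (2 * (X.card * L.card)) := by gcongr
    _ = _ := by
      push_cast
      ring

end PointLineEnergy

/-- The Cauchy–Schwarz bound for the number of collisions of a map. -/
lemma Finset.sq_card_le_card_mul_card_filter_eq {α β : Type*} {s : Finset α} {t : Finset β}
    {f : α → β} (hf : ∀ x ∈ s, f x ∈ t) :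
    s.card ^ 2 ≤ t.card * ((s ×ˢ s).filter fun r => f r.1 = f r.2).card := by
  have h : ((s ×ˢ s).filter fun r => f r.1 = f r.2).card =
      ∑ y ∈ t, (s.filter fun x => f x = y).card ^ 2 := by
    rw [Finset.card_eq_sum_card_fiberwise (f := fun r => f r.1) (t := t)]
    · refine Finset.sum_congr rfl fun y _ => ?_
      rw [sq, ← Finset.card_product]
      congr 1
      ext ⟨x, x'⟩
      simp only [Finset.mem_filter, Finset.mem_product]
      constructor
      · rintro ⟨⟨⟨hx, hx'⟩, h⟩, rfl⟩
        exact ⟨⟨hx, rfl⟩, hx', h.symm⟩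
      · rintro ⟨⟨hx, rfl⟩, hx', h⟩
        exact ⟨⟨⟨hx, hx'⟩, h.symm⟩, rfl⟩
    · intro r hr
      exact hf _ (Finset.mem_product.1 (Finset.mem_filter.1 hr).1).1
  rw [Finset.card_eq_sum_card_fiberwise hf, h]
  exact sq_sum_le_card_mul_sum_sq

section QuadraticImage

variable {K : Type*} [Field K]

/-- The affine maps `b ↦ b'` for which `a² + a b = a'² + a' b'`, where `a² ≠ a'²`. -/
noncomputable def collisionLines (A : Finset K) : Finset (K × K) :=
  ((A ×ˢ A).filter fun r => r.1 ^ 2 ≠ r.2 ^ 2).image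
    fun r => (r.1 / r.2, (r.1 ^ 2 - r.2 ^ 2) / r.2)

lemma fst_ne_zero_of_mem_collisionLines {A : Finset K} (hA : (0 : K) ∉ A) {l : K × K}
    (hl : l ∈ collisionLines A) : l.1 ≠ 0 := by
  obtain ⟨⟨a, a'⟩, h, rfl⟩ := Finset.mem_image.1 hl
  obtain ⟨h, -⟩ := Finset.mem_filter.1 h
  obtain ⟨h, h'⟩ := Finset.mem_product.1 h
  exact div_ne_zero (ne_of_mem_of_not_mem h hA) (ne_of_mem_of_not_mem h' hA)

lemma card_collisionLines_le (A : Finset K) : (collisionLines A).card ≤ A.card ^ 2 := by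
  refine Finset.card_image_le.trans ((Finset.card_filter_le _ _).trans ?_)
  rw [Finset.card_product, sq]

lemma Finset.card_filter_quadratic_le (s : Finset K) (v w : K) :
    (s.filter fun x => x ^ 2 + v * x = w).card ≤ 2 := by
  rcases (s.filter fun x => x ^ 2 + v * x = w).eq_empty_or_nonempty with h | ⟨x, hx⟩
  · simp [h]
  · refine (Finset.card_le_card (t := {x, -v - x}) ?_).trans Finset.card_le_two
    intro y hy
    have h1 := (Finset.mem_filter.1 hx).2
    have h2 := (Finset.mem_filter.1 hy).2
    have h3 : (y - x) * (y - (-v - x)) = 0 := by linear_combination h2 - h1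
    rw [Finset.mem_insert, Finset.mem_singleton]
    rcases mul_eq_zero.1 h3 with h | h
    · exact Or.inl (sub_eq_zero.1 h)
    · exact Or.inr (sub_eq_zero.1 h)

lemma card_filter_collisionLines_le {A : Finset K} (hA : (0 : K) ∉ A) (u v : K) :
    ((collisionLines A).filter fun l => l.1 * u + l.2 = v).card ≤ 2 * A.card := by
  calc ((collisionLines A).filter fun l => l.1 * u + l.2 = v).card
      ≤ ((A ×ˢ A).filter fun r => r.2 ^ 2 + v * r.2 = r.1 ^ 2 + r.1 * u).card := by
        rw [collisionLines, Finset.filter_image]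
        refine Finset.card_image_le.trans (Finset.card_le_card ?_)
        intro r hr
        obtain ⟨hr, h⟩ := Finset.mem_filter.1 hr
        have hr := (Finset.mem_filter.1 hr).1
        refine Finset.mem_filter.2 ⟨hr, ?_⟩
        have h0 : r.2 ≠ 0 := ne_of_mem_of_not_mem (Finset.mem_product.1 hr).2 hA
        rw [← h]
        field_simp
        ring
    _ = ∑ a ∈ A, (A.filter fun x => x ^ 2 + v * x = a ^ 2 + a * u).card := by
        simp_rw [Finset.card_filter]
        rw [Finset.sum_product]
    _ ≤ ∑ a ∈ A, 2 := Finset.sum_le_sum fun a _ => Finset.card_filter_quadratic_le _ _ _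
    _ = 2 * A.card := by simp [mul_comm]

/-- Collisions of `x² + x y` are incidences between points of `B × B` and the collision lines,
apart from the trivial ones. -/
lemma card_collisions_le {A : Finset K} (hA : (0 : K) ∉ A) (B : Finset K) :
    (((A ×ˢ B) ×ˢ (A ×ˢ B)).filter fun r =>
      r.1.1 ^ 2 + r.1.1 * r.1.2 = r.2.1 ^ 2 + r.2.1 * r.2.2).card ≤
    2 * (A.card * B.card) +
      ((B ×ˢ collisionLines A).filter fun p => p.2.1 * p.1 + p.2.2 ∈ B).card := by
  set S := ((A ×ˢ B) ×ˢ (A ×ˢ B)).filter fun r =>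
      r.1.1 ^ 2 + r.1.1 * r.1.2 = r.2.1 ^ 2 + r.2.1 * r.2.2 with hS
  have hmem : ∀ r ∈ S, r.1 ∈ A ×ˢ B ∧ r.2.2 ∈ B ∧ r.1.1 ∈ A ∧ r.1.2 ∈ B ∧ r.2.1 ∈ A ∧ r.2.1 ≠ 0 ∧
      r.1.1 ^ 2 + r.1.1 * r.1.2 = r.2.1 ^ 2 + r.2.1 * r.2.2 := by
    intro r hr
    obtain ⟨hr, h⟩ := Finset.mem_filter.1 hr
    obtain ⟨h1, h2⟩ := Finset.mem_product.1 hr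
    have h3 := Finset.mem_product.1 h1
    have h4 := Finset.mem_product.1 h2
    exact ⟨h1, h4.2, h3.1, h3.2, h4.1, ne_of_mem_of_not_mem h4.1 hA, h⟩
  rw [← Finset.card_filter_add_card_filter_not (s := S) fun r => r.1.1 ^ 2 = r.2.1 ^ 2]
  refine add_le_add ?_ ?_
  · rw [Finset.card_eq_sum_card_fiberwise (f := Prod.fst) (t := A ×ˢ B)]
    · refine (Finset.sum_le_card_nsmul _ _ 2 ?_).trans (by simp [mul_comm])
      intro p _
      refine (Finset.card_le_card_of_injOn (fun r => r.2.1) (t := {p.1, -p.1}) ?_ ?_).trans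
        Finset.card_le_two
      · intro r hr
        obtain ⟨hrS, rfl⟩ := Finset.mem_filter.1 hr
        have h := (Finset.mem_filter.1 hrS).2
        rcases sq_eq_sq_iff_eq_or_eq_neg.1 h.symm with h | h <;> simp [h]
      · intro r hr r' hr' h
        obtain ⟨hr, h1⟩ := Finset.mem_filter.1 hr
        obtain ⟨hr', h1'⟩ := Finset.mem_filter.1 hr'
        obtain ⟨-, -, -, -, -, h2, h3⟩ := hmem r (Finset.mem_filter.1 hr).1
        obtain ⟨-, -, -, -, -, -, h3'⟩ := hmem r' (Finset.mem_filter.1 hr').1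
        have h4 : r.1 = r'.1 := h1.trans h1'.symm
        simp only at h
        rw [← h4, ← h] at h3'
        refine Prod.ext h4 (Prod.ext h (mul_left_cancel₀ h2 ?_))
        linear_combination h3' - h3
    · intro r hr
      exact (hmem r (Finset.mem_filter.1 hr).1).1
  · apply Finset.card_le_card_of_injOn fun r =>
      (r.1.2, r.1.1 / r.2.1, (r.1.1 ^ 2 - r.2.1 ^ 2) / r.2.1)
    · intro r hr
      obtain ⟨hr, h⟩ := Finset.mem_filter.1 hr
      obtain ⟨-, h1, h2, h3, h4, h5, h6⟩ := hmem r hr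
      refine Finset.mem_filter.2 ⟨Finset.mem_product.2 ⟨h3, Finset.mem_image.2
        ⟨(r.1.1, r.2.1), Finset.mem_filter.2 ⟨Finset.mem_product.2 ⟨h2, h4⟩, h⟩, rfl⟩⟩, ?_⟩
      convert h1 using 1
      simp only
      field_simp
      linear_combination h6
    · rintro ⟨⟨a, b⟩, a', b'⟩ hr ⟨⟨c, d⟩, c', d'⟩ hr' h
      obtain ⟨hr, hne⟩ := Finset.mem_filter.1 hr
      obtain ⟨hr', -⟩ := Finset.mem_filter.1 hr'
      obtain ⟨-, -, -, -, -, h5, h6⟩ := hmem _ hr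
      obtain ⟨-, -, -, -, -, h5', h6'⟩ := hmem _ hr'
      simp only [Prod.mk.injEq] at h h5 h5' h6 h6' hne
      obtain ⟨rfl, h7, h8⟩ := h
      have h9 : a = c / c' * a' := by rw [← h7, div_mul_cancel₀ _ h5]
      have h10 : c = c / c' * c' := by rw [div_mul_cancel₀ _ h5']
      set m := c / c'
      rw [div_eq_div_iff h5 h5', h9, h10] at h8
      have hm : m ^ 2 - 1 ≠ 0 := by
        intro hm
        apply hne
        rw [h9]
        linear_combination a' ^ 2 * hm
      have h11 : a' = c' := by
        apply mul_left_cancel₀ (mul_ne_zero hm (mul_ne_zero h5 h5'))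
        linear_combination h8
      subst h11
      have h12 : a = c := h9.trans h10.symm
      subst h12
      have : b' = d' := by
        apply mul_left_cancel₀ h5
        linear_combination h6' - h6
      rw [this]

lemma sq_card_incidences_le (X : Finset K) (L : Finset (K × K)) :
    ((X ×ˢ L).filter fun p => p.2.1 * p.1 + p.2.2 ∈ X).card ^ 2 ≤
      X.card * (((X ×ˢ L) ×ˢ (X ×ˢ L)).filter fun r =>
        r.2.2.1 * r.1.1 + r.2.2.2 = r.1.2.1 * r.2.1 + r.1.2.2).card := by
  refine (Finset.sq_card_le_card_mul_card_filter_eq (t := X)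
    (f := fun p : K × K × K => p.2.1 * p.1 + p.2.2)
    fun p hp => (Finset.mem_filter.1 hp).2).trans (Nat.mul_le_mul_left _ ?_)
  apply Finset.card_le_card_of_injOn fun r => ((r.1.1, r.2.2), (r.2.1, r.1.2))
  · intro r hr
    obtain ⟨hr, h⟩ := Finset.mem_filter.1 hr
    obtain ⟨h1, h2⟩ := Finset.mem_product.1 hr
    have h1 := Finset.mem_product.1 (Finset.mem_filter.1 h1).1
    have h2 := Finset.mem_product.1 (Finset.mem_filter.1 h2).1
    exact Finset.mem_filter.2 ⟨Finset.mem_product.2 ⟨Finset.mem_product.2 ⟨h1.1, h2.2⟩,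
      Finset.mem_product.2 ⟨h2.1, h1.2⟩⟩, h⟩
  · rintro ⟨⟨x, l⟩, x', l'⟩ - ⟨⟨y, k⟩, y', k'⟩ - h
    simp only [Prod.mk.injEq] at h ⊢
    tauto

/-- The lower bound for the image of `x² + x y`, in integral form, when `0 ∉ A`. -/
theorem card_sq_mul_card_cube_le [Infinite K] {A B : Finset K} (hA : A.Nonempty)
    (hA0 : (0 : K) ∉ A) (hB : B.Nonempty)
    (hchar : ∀ m : ℕ, 0 < m → (m : ℝ) ≤ 2 * √(2 * (A.card ^ 2 * B.card) : ℝ) → (m : K) ≠ 0) :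
    (A.card : ℝ) ^ 2 * B.card ^ 3 ≤
      10 ^ 16 * (((A ×ˢ B).image fun ab => ab.1 ^ 2 + ab.1 * ab.2).card : ℝ) ^ 4 := by
  set Z := (A ×ˢ B).image fun ab => ab.1 ^ 2 + ab.1 * ab.2 with hZ
  have ha : (1 : ℝ) ≤ A.card := by exact_mod_cast hA.card_pos
  have hb : (1 : ℝ) ≤ B.card := by exact_mod_cast hB.card_pos
  have hBZ : (B.card : ℝ) ≤ Z.card := by
    obtain ⟨a, ha⟩ := hA
    have ha0 : a ≠ 0 := ne_of_mem_of_not_mem ha hA0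
    have : B.card ≤ Z.card := by
      apply Finset.card_le_card_of_injOn fun b => a ^ 2 + a * b
      · intro b hb
        exact Finset.mem_image.2 ⟨(a, b), Finset.mem_product.2 ⟨ha, hb⟩, rfl⟩
      · intro b _ b' _ h
        exact mul_left_cancel₀ ha0 (add_left_cancel h)
    exact_mod_cast this
  set L := collisionLines A with hL
  set I := ((B ×ˢ L).filter fun p => p.2.1 * p.1 + p.2.2 ∈ B).card with hI
  set J := (((B ×ˢ L) ×ˢ (B ×ˢ L)).filter fun r =>
        r.2.2.1 * r.1.1 + r.2.2.2 = r.1.2.1 * r.2.1 + r.1.2.2).card with hJ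
  set a : ℝ := (A.card : ℝ) with ha'
  set b : ℝ := (B.card : ℝ) with hb'
  have hLa : (L.card : ℝ) ≤ a ^ 2 := by
    rw [ha']
    exact_mod_cast card_collisionLines_le A
  by_cases hab : a ^ 2 < b
  · calc a ^ 2 * b ^ 3 ≤ b * b ^ 3 := by gcongr
      _ = 1 * b ^ 4 := by ring
      _ ≤ 10 ^ 16 * (Z.card : ℝ) ^ 4 := by gcongr; norm_num
  rw [not_lt] at hab
  have hBL : 2 * (b * L.card) ≤ 2 * (a ^ 2 * b) := by nlinarith
  have hJle : (J : ℝ) ≤ 4 * (b * L.card) *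
      (2 * (b + (2 * A.card : ℕ)) + 3000000 * √(2 * (b * L.card))) := by
    apply card_eval_eq_le B L (fun l hl => fst_ne_zero_of_mem_collisionLines hA0 hl)
      (card_filter_collisionLines_le hA0)
    intro m hm hm'
    exact hchar m hm (hm'.trans (by gcongr))
  set r := √(a ^ 2 * b) with hr
  have hr2 : r ^ 2 = a ^ 2 * b := Real.sq_sqrt (by positivity)
  have hr0 : 0 ≤ r := Real.sqrt_nonneg _
  have har : a ≤ r := Real.le_sqrt_of_sq_le (by nlinarith)
  have hbr : b ≤ r := Real.le_sqrt_of_sq_le (by nlinarith)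
  have hsq : √(2 * (b * L.card)) ≤ 3 / 2 * r := by
    apply Real.sqrt_le_iff.2
    constructor
    · positivity
    · nlinarith
  have hJr : (J : ℝ) ≤ 2 * 10 ^ 7 * r ^ 3 := by
    refine hJle.trans ?_
    push_cast
    rw [← ha']
    calc 4 * (b * L.card) * (2 * (b + 2 * a) + 3000000 * √(2 * (b * L.card)))
        ≤ 4 * r ^ 2 * (2 * (r + 2 * r) + 3000000 * (3 / 2 * r)) := by
          gcongr
          linarith
      _ ≤ 2 * 10 ^ 7 * r ^ 3 := by nlinarith [pow_nonneg hr0 3]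
  have hIJ : (I : ℝ) ^ 2 ≤ b * J := by
    rw [hb']
    exact_mod_cast sq_card_incidences_le B L
  have hI2 : (I : ℝ) ^ 2 ≤ b * (2 * 10 ^ 7 * r ^ 3) := hIJ.trans (by gcongr)
  have hI4 : (I : ℝ) ^ 4 ≤ 4 * 10 ^ 14 * (a ^ 6 * b ^ 5) := by
    calc (I : ℝ) ^ 4 = ((I : ℝ) ^ 2) ^ 2 := by ring
      _ ≤ (b * (2 * 10 ^ 7 * r ^ 3)) ^ 2 := by gcongr
      _ = 4 * 10 ^ 14 * (b ^ 2 * (r ^ 2) ^ 3) := by ring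
      _ = _ := by
        rw [hr2]
        ring
  have hCS : (a * b) ^ 2 ≤ Z.card * (2 * (a * b) + I) := by
    have h1 := Finset.sq_card_le_card_mul_card_filter_eq (s := A ×ˢ B) (t := Z)
      (f := fun ab => ab.1 ^ 2 + ab.1 * ab.2) fun p hp => Finset.mem_image_of_mem _ hp
    have h2 := h1.trans (Nat.mul_le_mul_left _ (card_collisions_le hA0 B))
    rw [Finset.card_product] at h2
    rw [ha', hb']
    exact_mod_cast h2
  have h4 : (2 * (a * b) + I) ^ 4 ≤ 10 ^ 16 * (a ^ 6 * b ^ 5) := by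
    have h5 : (2 * (a * b) + I) ^ 4 ≤ 8 * ((2 * (a * b)) ^ 4 + (I : ℝ) ^ 4) := by
      have := add_pow_le (a := 2 * (a * b)) (b := (I : ℝ)) (by positivity) (by positivity) 4
      norm_num at this ⊢
      exact this
    have h6 : a ^ 4 * b ^ 4 ≤ a ^ 6 * b ^ 5 :=
      mul_le_mul (pow_le_pow_right₀ ha (by norm_num)) (pow_le_pow_right₀ hb (by norm_num))
        (by positivity) (by positivity)
    have h7 : (2 * (a * b)) ^ 4 = 16 * (a ^ 4 * b ^ 4) := by ring
    have h8 : 0 ≤ a ^ 6 * b ^ 5 := by positivity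
    rw [h7] at h5
    linarith
  have h8 : a ^ 6 * b ^ 5 * (a ^ 2 * b ^ 3) ≤ a ^ 6 * b ^ 5 * (10 ^ 16 * (Z.card : ℝ) ^ 4) := by
    calc a ^ 6 * b ^ 5 * (a ^ 2 * b ^ 3) = ((a * b) ^ 2) ^ 4 := by ring
      _ ≤ (Z.card * (2 * (a * b) + I)) ^ 4 := by gcongr
      _ = (Z.card : ℝ) ^ 4 * (2 * (a * b) + I) ^ 4 := by ring
      _ ≤ (Z.card : ℝ) ^ 4 * (10 ^ 16 * (a ^ 6 * b ^ 5)) := by gcongr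
      _ = _ := by ring
  exact le_of_mul_le_mul_left h8 (by positivity)

end QuadraticImage

theorem stmt_12 :
    ∃ c C : ℝ, 0 < c ∧ 0 < C ∧
      ∀ (F : Type) [Field F] (A B : Finset F),
        A.Nonempty → B.Nonempty → A ≠ {0} →
        (∀ p : ℕ, p.Prime → CharP F p →
          ((A.card : ℝ) ^ 2 * B.card) ≤ c * (p : ℝ) ^ 2) →
        C * min ((A.card : ℝ) ^ ((1 : ℝ) / 2) * (B.card : ℝ) ^ ((3 : ℝ) / 4))
              ((B.card : ℝ) ^ 2) ≤
          (((A ×ˢ B).image (fun ab => ab.1 ^ 2 + ab.1 * ab.2)).card : ℝ) := by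
  refine ⟨1 / 16, 1 / 20000, by norm_num, by norm_num, ?_⟩
  intro F _ A B hA hB hA0 hp
  let φ : F ↪ AlgebraicClosure F :=
    ⟨algebraMap F (AlgebraicClosure F), (algebraMap F (AlgebraicClosure F)).injective⟩
  have hφ : ∀ x, φ x = algebraMap F (AlgebraicClosure F) x := fun _ => rfl
  have hA' : (A.erase 0).Nonempty := by
    rw [Finset.nonempty_iff_ne_empty]
    intro h
    rcases Finset.erase_eq_empty_iff _ _ |>.1 h with h | h
    · exact hA.ne_empty h
    · exact hA0 h
  have hle : (A.card : ℝ) ≤ 2 * (A.erase 0).card := by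
    have h1 := Finset.pred_card_le_card_erase (s := A) (a := 0)
    have h2 := hA'.card_pos
    exact_mod_cast (by omega : A.card ≤ 2 * (A.erase 0).card)
  have hge : ((A.erase 0).card : ℝ) ≤ A.card := by
    exact_mod_cast Finset.card_le_card (Finset.erase_subset _ _)
  have hmain := card_sq_mul_card_cube_le (A := (A.erase 0).map φ) (B := B.map φ)
    (hA'.map) (by simp [hφ]) (hB.map) (by
      intro m hm hm' hm0
      rw [Finset.card_map, Finset.card_map] at hm'
      have hmF : (m : F) = 0 := by
        apply (algebraMap F (AlgebraicClosure F)).injective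
        simpa using hm0
      obtain ⟨p, hF⟩ := CharP.exists F
      have hpm : p ∣ m := (CharP.cast_eq_zero_iff F p m).1 hmF
      have hp0 : p ≠ 0 := by
        rintro rfl
        exact hm.ne' (Nat.eq_zero_of_zero_dvd hpm)
      have hple : (p : ℝ) ≤ m := by exact_mod_cast Nat.le_of_dvd hm hpm
      have hpp : 0 < (p : ℝ) := by exact_mod_cast Nat.pos_of_ne_zero hp0
      have hbound := hp p ((CharP.char_is_prime_or_zero F p).resolve_right hp0) hF
      have hlt : √(2 * ((A.erase 0).card ^ 2 * B.card) : ℝ) < p / 2 := by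
        rw [Real.sqrt_lt' (by positivity)]
        have : ((A.erase 0).card : ℝ) ^ 2 * B.card ≤ (A.card : ℝ) ^ 2 * B.card := by gcongr
        nlinarith
      linarith)
  set Z := (A ×ˢ B).image fun ab => ab.1 ^ 2 + ab.1 * ab.2 with hZ
  have hZle : ((((A.erase 0).map φ) ×ˢ (B.map φ)).image
      fun ab => ab.1 ^ 2 + ab.1 * ab.2).card ≤ Z.card := by
    rw [← Finset.card_map φ]
    apply Finset.card_le_card
    intro z hz
    obtain ⟨⟨x, y⟩, hxy, rfl⟩ := Finset.mem_image.1 hz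
    obtain ⟨hx, hy⟩ := Finset.mem_product.1 hxy
    obtain ⟨a, ha, rfl⟩ := Finset.mem_map.1 hx
    obtain ⟨b, hb, rfl⟩ := Finset.mem_map.1 hy
    exact Finset.mem_map.2 ⟨a ^ 2 + a * b, Finset.mem_image.2
      ⟨(a, b), Finset.mem_product.2 ⟨Finset.mem_of_mem_erase ha, hb⟩, rfl⟩, by simp [hφ]⟩
  rw [Finset.card_map, Finset.card_map] at hmain
  have hZ4 : (A.card : ℝ) ^ 2 * B.card ^ 3 ≤ (20000 * Z.card : ℝ) ^ 4 := by
    calc (A.card : ℝ) ^ 2 * B.card ^ 3 ≤ (2 * ((A.erase 0).card : ℝ)) ^ 2 * B.card ^ 3 := by gcongr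
      _ = 4 * (((A.erase 0).card : ℝ) ^ 2 * B.card ^ 3) := by ring
      _ ≤ 4 * (10 ^ 16 * (Z.card : ℝ) ^ 4) :=
        mul_le_mul_of_nonneg_left (hmain.trans (by gcongr)) (by norm_num)
      _ ≤ (20000 * Z.card : ℝ) ^ 4 := by nlinarith [pow_nonneg (Nat.cast_nonneg (α := ℝ) Z.card) 4]
  have hroot : (A.card : ℝ) ^ ((1 : ℝ) / 2) * (B.card : ℝ) ^ ((3 : ℝ) / 4) ≤ 20000 * Z.card := by
    refine le_of_pow_le_pow_left₀ (n := 4) (by norm_num) (by positivity)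
      (le_trans (le_of_eq ?_) hZ4)
    rw [mul_pow, ← Real.rpow_mul_natCast (by positivity), ← Real.rpow_mul_natCast (by positivity)]
    norm_num
  have := (min_le_left _ ((B.card : ℝ) ^ 2)).trans hroot
  linarith
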